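/- arXiv:1409.8549 — 13 statements merged into one kernel-verified Lean document; each statement's English description precedes it below -/
import Mathlib

section
/- Let p be a prime, q = p^h, and let s ≥ 2 and n ≥ 2 be integers with p | n−1; write n−1 = m·p^v with v ≥ 1 and p ∤ m. Assume p > 5 if s = 2 and p > s² if s ≥ 3. Let c_{ij} ∈ F_q for 0 ≤ i+j ≤ s, not all zero, and suppose that the homogeneous polynomial F(x,y,z) = Σ_{i+j+t=s} c_{ij} x^{in} y^{jn} z^{tn} of degree sn defines a nonsingular projective plane curve over F_q. Then F(x,y,1) divides the polynomial g(x,y) = Σ_{0 ≤ i+j ≤ s} c_{ij} x^{i(n+q−1)} y^{j(n+q−1)} in F_q[x,y] if and only if n·(p^v − 1) = q − 1 and, for all indices (i,j) and (k,l) with c_{kl} ≠ 0, the ratio c_{ij}/c_{kl} is fixed by the map x ↦ x^{p^v}. (This divisibility is the algebraic formulation of Theorem 3.3: it expresses that the image of a generic point of the curve under the q-power Frobenius lies on the s-th osculating curve at that point.) -/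
open MvPolynomial

namespace MvPolynomial

theorem three_le_height_ker_eval_zero {K : Type*} [Field K] :
    (3 : ℕ∞) ≤ (RingHom.ker (eval (0 : Fin 3 → K))).height := by
  let f : MvPolynomial (Fin 3) K →ₐ[K] MvPolynomial (Fin 3) K := aeval ![0, X 1, X 2]
  let g : MvPolynomial (Fin 3) K →ₐ[K] MvPolynomial (Fin 3) K := aeval ![0, 0, X 2]
  have hgf : g.comp f = g := by
    ext i : 1
    fin_cases i <;> simp [f, g]
  have hge : (aeval (0 : Fin 3 → K)).comp g = aeval (0 : Fin 3 → K) := by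
    ext i : 1
    fin_cases i <;> simp [g]
  have := RingHom.ker_isPrime f.toRingHom
  have := RingHom.ker_isPrime g.toRingHom
  have := RingHom.ker_isPrime (eval (0 : Fin 3 → K))
  have h1 : (⊥ : Ideal (MvPolynomial (Fin 3) K)) < RingHom.ker f.toRingHom := by
    refine SetLike.lt_iff_le_and_exists.mpr ⟨bot_le, X 0, ?_, ?_⟩ <;> simp [RingHom.mem_ker, f]
  have h2 : RingHom.ker f.toRingHom < RingHom.ker g.toRingHom := by
    refine SetLike.lt_iff_le_and_exists.mpr ⟨fun a ha => ?_, X 1, ?_, ?_⟩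
    · have := DFunLike.congr_fun hgf a
      have ha' : f a = 0 := ha
      rw [AlgHom.comp_apply, ha', map_zero] at this
      exact this.symm
    · simp [RingHom.mem_ker, g]
    · simp [RingHom.mem_ker, f]
  have h3 : RingHom.ker g.toRingHom < RingHom.ker (eval (0 : Fin 3 → K)) := by
    refine SetLike.lt_iff_le_and_exists.mpr ⟨fun a ha => ?_, X 2, ?_, ?_⟩
    · have := DFunLike.congr_fun hge a
      have ha' : g a = 0 := ha
      rw [AlgHom.comp_apply, ha', map_zero] at this
      exact this.symm
    · simp [RingHom.mem_ker]
    · simp [RingHom.mem_ker, g]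
  have h1' := Ideal.height_add_one_le_of_lt_of_isPrime h1
  have h2' := Ideal.height_add_one_le_of_lt_of_isPrime h2
  have h3' := Ideal.height_add_one_le_of_lt_of_isPrime h3
  calc (3 : ℕ∞) = 0 + 1 + 1 + 1 := by norm_num
    _ ≤ (⊥ : Ideal (MvPolynomial (Fin 3) K)).height + 1 + 1 + 1 := by gcongr; exact zero_le
    _ ≤ _ := by
      refine le_trans ?_ h3'
      gcongr
      refine le_trans ?_ h2'
      gcongr

/-- Two ternary polynomials vanishing at the origin have a further common zero. -/
theorem exists_ne_zero_common_zero {K : Type*} [Field K] [IsAlgClosed K]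
    {A B : MvPolynomial (Fin 3) K} (hA : eval 0 A = 0) (hB : eval 0 B = 0) :
    ∃ P ≠ 0, eval P A = 0 ∧ eval P B = 0 := by
  by_contra! H
  have hprime := RingHom.ker_isPrime (eval (0 : Fin 3 → K))
  have hle : RingHom.ker (eval (0 : Fin 3 → K)) ≤ (Ideal.span {A, B}).radical := by
    rw [← vanishingIdeal_zeroLocus_eq_radical (K := K), zeroLocus_span]
    intro f hf x hx
    have hx0 : x = 0 := by
      by_contra h0
      exact H x h0 (by simpa [coe_aeval_eq_eval] using hx A (by simp))
        (by simpa [coe_aeval_eq_eval] using hx B (by simp))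
    simpa [hx0, coe_aeval_eq_eval, RingHom.mem_ker] using hf
  have hmin : RingHom.ker (eval (0 : Fin 3 → K)) ∈ (Ideal.span {A, B}).minimalPrimes := by
    refine ⟨⟨hprime, ?_⟩, fun J hJ _ => hle.trans (hJ.1.radical_le_iff.mpr hJ.2)⟩
    rw [Ideal.span_le]
    rintro f (rfl | rfl) <;> assumption
  have h := (Ideal.height_le_card_of_mem_minimalPrimes_span (Set.toFinite _) hmin)
  have h3 := three_le_height_ker_eval_zero.trans h
  have h4 : (3 : ℕ) ≤ Set.ncard {A, B} := by exact_mod_cast h3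
  have := Set.ncard_insert_le A {B}
  rw [Set.ncard_singleton] at this
  omega

/-- A factor of a nonzero homogeneous polynomial that does not vanish at the origin is a unit. -/
theorem IsHomogeneous.isUnit_of_mul {K σ : Type*} [Field K] {A B : MvPolynomial σ K} {d : ℕ}
    (hAB : (A * B).IsHomogeneous d) (hA : A ≠ 0) (hB : eval 0 B ≠ 0) : IsUnit B := by
  let φ : MvPolynomial σ K →ₐ[K] Polynomial (MvPolynomial σ K) :=
    MvPolynomial.aeval fun i => Polynomial.C (X i) * Polynomial.X
  have h1 : ((Polynomial.aeval (1 : MvPolynomial σ K)).restrictScalars K).comp φ =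
      AlgHom.id K _ := by
    ext i : 1
    simp [φ]
  have h0 : ((Polynomial.aeval (0 : MvPolynomial σ K)).restrictScalars K).comp φ =
      (Algebra.ofId K _).comp (MvPolynomial.aeval (0 : σ → K)) := by
    ext i : 1
    simp [φ]
  have hφ : φ (A * B) = Polynomial.C (A * B) * Polynomial.X ^ d := by
    conv_lhs => rw [(A * B).as_sum]
    conv_rhs => rw [(A * B).as_sum]
    rw [map_sum, map_sum, Finset.sum_mul]
    refine Finset.sum_congr rfl fun m hm => ?_
    rw [MvPolynomial.aeval_monomial, monomial_eq, hAB.degree_eq_sum_deg_support hm]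
    simp only [Finsupp.prod, mul_pow, Finset.prod_mul_distrib, Finset.prod_pow_eq_pow_sum,
      algebraMap_eq, Polynomial.algebraMap_apply, map_mul, map_prod, map_pow, mul_assoc]
  have hB0 : (φ B).coeff 0 = C (eval 0 B) := by
    have := DFunLike.congr_fun h0 B
    simpa [Polynomial.coeff_zero_eq_eval_zero, coe_aeval_eq_eval, Algebra.ofId_apply,
      algebraMap_eq] using this
  have hinj : Function.Injective φ := fun a b hab => by
    have ha : Polynomial.aeval 1 (φ a) = a := DFunLike.congr_fun h1 a
    have hb : Polynomial.aeval 1 (φ b) = b := DFunLike.congr_fun h1 b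
    rw [← ha, hab, hb]
  have hφA : φ A ≠ 0 := (map_ne_zero_iff φ hinj).mpr hA
  have hBne : B ≠ 0 := by rintro rfl; simp at hB
  have hφB : φ B ≠ 0 := (map_ne_zero_iff φ hinj).mpr hBne
  have hX : ¬ (Polynomial.X ∣ φ B) := by
    rw [Polynomial.X_dvd_iff, hB0]
    simpa using hB
  have hdvd : Polynomial.X ^ d ∣ φ A :=
    Polynomial.prime_X.pow_dvd_of_dvd_mul_right d hX
      (by rw [← map_mul, hφ]; exact dvd_mul_left _ _)
  have hdA : d ≤ (φ A).natDegree := by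
    simpa using Polynomial.natDegree_le_of_dvd hdvd hφA
  have hdeg : (φ A).natDegree + (φ B).natDegree = d := by
    rw [← Polynomial.natDegree_mul hφA hφB, ← map_mul, hφ,
      Polynomial.natDegree_C_mul_X_pow _ _ (mul_ne_zero hA hBne)]
  have hB' : B = C (eval 0 B) := by
    have := DFunLike.congr_fun h1 B
    rw [← hB0]
    have h := Polynomial.eq_C_of_natDegree_eq_zero (show (φ B).natDegree = 0 by omega)
    have : Polynomial.aeval 1 (φ B) = B := this
    rw [h] at this
    simpa using this.symm
  rw [hB']
  exact (isUnit_iff_ne_zero.mpr hB).map C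

/-- The hypersurface cut out by `G` has no singular point with a nonzero coordinate. -/
def IsNonsingularForm {K σ : Type*} [CommSemiring K] (G : MvPolynomial σ K) : Prop :=
  ∀ P : σ → K, eval P G = 0 → (∀ k, eval P (pderiv k G) = 0) → P = 0

/-- A nonsingular ternary form of positive degree over an algebraically closed field is
irreducible. -/
theorem IsNonsingularForm.irreducible {K : Type*} [Field K] [IsAlgClosed K]
    {G : MvPolynomial (Fin 3) K} {d : ℕ} (hG : IsNonsingularForm G) (hd : G.IsHomogeneous d)
    (hd0 : d ≠ 0) : Irreducible G := by
  have hG0 : G ≠ 0 := by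
    rintro rfl
    exact one_ne_zero (hG 1 (by simp) (by simp))
  have hev : eval 0 G = 0 := by
    rw [eval_zero]
    exact hd.coeff_eq_zero (by simpa using hd0.symm)
  refine ⟨fun h => (h.map (eval 0)).ne_zero hev, fun A B hAB => ?_⟩
  subst hAB
  by_contra! hu
  have hA : eval 0 A = 0 := by
    by_contra h
    exact hu.1 (IsHomogeneous.isUnit_of_mul (mul_comm A B ▸ hd) (right_ne_zero_of_mul hG0) h)
  have hB : eval 0 B = 0 := by
    by_contra h
    exact hu.2 (hd.isUnit_of_mul (left_ne_zero_of_mul hG0) h)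
  obtain ⟨P, hP, hPA, hPB⟩ := exists_ne_zero_common_zero hA hB
  exact hP (hG P (by simp [hPA]) fun k => by simp [hPA, hPB])

theorem pderiv_expand {R σ : Type*} [CommSemiring R] (n : ℕ) (k : σ) (Q : MvPolynomial σ R) :
    pderiv k (expand n Q) = (n : MvPolynomial σ R) * X k ^ (n - 1) * expand n (pderiv k Q) := by
  classical
  induction Q using MvPolynomial.induction_on with
  | C a => simp
  | add f g hf hg => simp [hf, hg, mul_add]
  | mul_X f i hf =>
    rw [map_mul, expand_X, pderiv_mul, hf, pderiv_mul, pderiv_pow, pderiv_X]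
    by_cases h : i = k
    · subst h; simp; ring
    · simp [Ne.symm h]; ring

theorem eval_map_pow_iterateFrobenius {K σ : Type*} [CommSemiring K] (p e : ℕ) [ExpChar K p]
    (P : σ → K) (Q : MvPolynomial σ K) :
    eval (P ^ p ^ e) (map (iterateFrobenius K p e) Q) = (eval P Q) ^ p ^ e := by
  rw [← iterateFrobenius_def p e (eval P Q), eval_map, eval₂_eq, eval_eq, map_sum]
  refine Finset.sum_congr rfl fun d _ => ?_
  simp only [iterateFrobenius_def, mul_pow, Pi.pow_apply, pow_right_comm,
    ← Finset.prod_pow]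

/-- Nonsingularity of `Q^σ(xⁿ)`, with `σ` a power of Frobenius and `2 ≤ n`, gives that of `Q(x^N)`
whenever `N` is invertible. -/
theorem IsNonsingularForm.expand_of_expand_map {K σ : Type*} [Field K] [IsAlgClosed K] {p e n N : ℕ}
    [ExpChar K p] {Q : MvPolynomial σ K} (hn : 2 ≤ n) (hN : (N : K) ≠ 0)
    (hQ : IsNonsingularForm (expand n (map (iterateFrobenius K p e) Q))) :
    IsNonsingularForm (expand N Q) := by
  have hN0 : N ≠ 0 := by rintro rfl; simp at hN
  have hpe : p ^ e ≠ 0 := pow_ne_zero _ (expChar_pos K p).ne'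
  intro P hP hdP
  choose R hR using fun k => IsAlgClosed.exists_pow_nat_eq (((P ^ N) ^ p ^ e) k) (by omega : 0 < n)
  replace hR : R ^ n = (P ^ N) ^ p ^ e := _root_.funext hR
  have hR0 : R = 0 := by
    refine hQ R ?_ fun k => ?_
    · rw [eval_expand, hR, eval_map_pow_iterateFrobenius, ← eval_expand, hP, zero_pow hpe]
    · have hk := hdP k
      rw [pderiv_expand] at hk ⊢
      simp only [map_mul, map_pow, eval_X, map_natCast, mul_eq_zero, hN, false_or, pow_eq_zero_iff',
        eval_expand, hR, pderiv_map, eval_map_pow_iterateFrobenius] at hk ⊢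
      rcases hk with hk | hk
      · have : R k ^ n = 0 := by
          rw [← Pi.pow_apply, hR]
          rw [Pi.pow_apply, Pi.pow_apply, hk.1, zero_pow hN0, zero_pow hpe]
        left; right
        exact ⟨eq_zero_of_pow_eq_zero this, by omega⟩
      · right; exact ⟨hk, hpe⟩
  ext k
  have := congrFun hR k
  rw [hR0, Pi.pow_apply, Pi.zero_apply, zero_pow (by omega)] at this
  exact eq_zero_of_pow_eq_zero (eq_zero_of_pow_eq_zero this.symm)

theorem IsHomogeneous.expand {R σ : Type*} [CommSemiring R] {Q : MvPolynomial σ R} {s : ℕ}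
    (hQ : Q.IsHomogeneous s) (n : ℕ) : (expand n Q).IsHomogeneous (n * s) :=
  hQ.aeval _ fun i => isHomogeneous_X_pow i n

/-- If `Q(xⁿ)` is a nonsingular ternary form and `Q(x^(p^e N))` vanishes on its affine zeros, with `N`
invertible, then `n = N` and the coefficients of `Q` are proportional to their `p^e`-th powers. -/
theorem IsNonsingularForm.eq_of_expand_vanishes {K : Type*} [Field K] [IsAlgClosed K] {p e n N s : ℕ}
    [ExpChar K p] {Q : MvPolynomial (Fin 3) K} (hs : s ≠ 0) (hhom : Q.IsHomogeneous s)
    (hn : 2 ≤ n) (hN : (N : K) ≠ 0) (hQ : IsNonsingularForm (MvPolynomial.expand n Q))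
    (h : ∀ P : Fin 3 → K, P 2 ≠ 0 → eval P (MvPolynomial.expand n Q) = 0 →
      eval P (MvPolynomial.expand (p ^ e * N) Q) = 0) :
    n = N ∧ ∃ w : K, w ≠ 0 ∧ ∀ m, coeff m Q ^ p ^ e = w * coeff m Q := by
  have hpe : p ^ e ≠ 0 := pow_ne_zero _ (expChar_pos K p).ne'
  have hN0 : N ≠ 0 := by rintro rfl; simp at hN
  obtain ⟨Q', rfl⟩ : ∃ Q', Q = map (iterateFrobenius K p e) Q' := by
    refine ⟨map (iterateFrobeniusEquiv K p e).symm.toRingHom Q, ?_⟩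
    rw [map_map]
    convert! (map_id Q).symm
    ext x
    exact (iterateFrobeniusEquiv K p e).apply_symm_apply x
  have hinj : Function.Injective (iterateFrobenius K p e) := RingHom.injective _
  have hhom' : Q'.IsHomogeneous s := hhom.of_map hinj
  have hG := hQ.expand_of_expand_map hn hN
  have hFirr := hQ.irreducible (hhom.expand n) (by positivity)
  have hGirr := hG.irreducible (hhom'.expand N) (by positivity)
  set F := MvPolynomial.expand n (map (iterateFrobenius K p e) Q') with hF
  have hprime : (Ideal.span {F}).IsPrime :=
    (Ideal.span_singleton_prime hFirr.ne_zero).mpr hFirr.prime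
  have hQ0 : map (iterateFrobenius K p e) Q' ≠ 0 := by
    intro h0
    exact hFirr.ne_zero (by rw [hF, h0, map_zero])
  have hQ'0 : Q' ≠ 0 := by rintro rfl; simp at hQ0
  have hFdeg : F.totalDegree = s * n := by
    rw [hF, totalDegree_expand, hhom.totalDegree hQ0]
  have hmem : X 2 * MvPolynomial.expand N Q' ∈ Ideal.span {F} := by
    rw [← IsPrime.vanishingIdeal_zeroLocus (K := K) (Ideal.span {F}), zeroLocus_span]
    intro P hP
    have hPF : eval P F = 0 := by simpa [coe_aeval_eq_eval] using hP F rfl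
    by_cases h2 : P 2 = 0
    · simp [h2]
    have := h P h2 hPF
    rw [eval_expand, mul_comm, pow_mul, eval_map_pow_iterateFrobenius] at this
    simp [eq_zero_of_pow_eq_zero this]
  rw [Ideal.mem_span_singleton] at hmem
  have hX : ¬ F ∣ X 2 := by
    rintro ⟨H, hH⟩
    have hH0 : H ≠ 0 := by rintro rfl; simp at hH
    have := congrArg MvPolynomial.totalDegree hH
    rw [totalDegree_mul_of_isDomain hFirr.ne_zero hH0, totalDegree_X, hFdeg] at this
    have : 2 ≤ s * n := by nlinarith [Nat.pos_of_ne_zero hs]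
    omega
  obtain ⟨u, hu⟩ := hFirr.associated_of_dvd hGirr ((hFirr.prime.dvd_or_dvd hmem).resolve_left hX)
  obtain ⟨a, ha, hua⟩ := MvPolynomial.isUnit_iff_eq_C_of_isReduced.mp u.isUnit
  rw [hua] at hu
  have ha0 : a ≠ 0 := ha.ne_zero
  have hnN : n = N := by
    have := congrArg MvPolynomial.totalDegree hu
    rw [totalDegree_mul_of_isDomain hFirr.ne_zero (by simpa), totalDegree_C, hFdeg,
      totalDegree_expand, hhom'.totalDegree hQ'0] at this
    exact Nat.eq_of_mul_eq_mul_left (Nat.pos_of_ne_zero hs) this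
  refine ⟨hnN, (a ^ p ^ e)⁻¹, inv_ne_zero (pow_ne_zero _ ha0), fun m => ?_⟩
  subst hnN
  have hCa : C a = MvPolynomial.expand n (C a : MvPolynomial (Fin 3) K) := by simp
  rw [hF, hCa, ← map_mul] at hu
  have hco := congrArg (coeff m) (expand_injective (by omega) hu)
  rw [mul_comm, coeff_C_mul, coeff_map] at hco
  rw [coeff_map, eq_inv_mul_iff_mul_eq₀ (pow_ne_zero _ ha0), ← mul_pow, hco,
    iterateFrobenius_def]

/-- Dehomogenization of `Q(xⁿ)` with respect to the last coordinate. -/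
theorem eval_expand_map_eq {F K : Type*} [Field F] [Field K] [Algebra F K] (s n : ℕ)
    (c : ℕ → ℕ → F) (P : Fin 3 → K) (hP : P 2 ≠ 0) :
    eval P (expand n (map (algebraMap F K) (∑ i ∈ Finset.range (s + 1),
      ∑ j ∈ Finset.range (s + 1 - i), C (c i j) * X 0 ^ i * X 1 ^ j * X 2 ^ (s - i - j)))) =
    P 2 ^ (s * n) * aeval ![P 0 / P 2, P 1 / P 2] (∑ i ∈ Finset.range (s + 1),
      ∑ j ∈ Finset.range (s + 1 - i), C (c i j) * X 0 ^ (i * n) * X 1 ^ (j * n)) := by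
  simp only [map_sum, Finset.mul_sum]
  refine Finset.sum_congr rfl fun i hi => Finset.sum_congr rfl fun j hj => ?_
  rw [Finset.mem_range] at hi hj
  obtain ⟨t, rfl⟩ : ∃ t, s = i + j + t := ⟨s - i - j, by omega⟩
  have : i + j + t - i - j = t := by omega
  simp [this, div_pow, ← pow_mul]
  field_simp
  ring

theorem coeff_ternary_sum {F : Type*} [CommSemiring F] {s i j : ℕ} (c : ℕ → ℕ → F)
    (hij : i + j ≤ s) :
    coeff (Finsupp.single 0 i + Finsupp.single 1 j + Finsupp.single 2 (s - i - j))
      (∑ i ∈ Finset.range (s + 1), ∑ j ∈ Finset.range (s + 1 - i),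
        C (c i j) * X 0 ^ i * X 1 ^ j * X 2 ^ (s - i - j) : MvPolynomial (Fin 3) F) = c i j := by
  have hmon (a b t : ℕ) : (C (c a b) * X 0 ^ a * X 1 ^ b * X 2 ^ t : MvPolynomial (Fin 3) F) =
      monomial (Finsupp.single 0 a + Finsupp.single 1 b + Finsupp.single 2 t) (c a b) := by
    simp only [X_pow_eq_monomial, C_mul_monomial, monomial_mul, mul_one]
  simp only [hmon, coeff_sum, coeff_monomial]
  rw [Finset.sum_eq_single i, Finset.sum_eq_single j]
  · simp
  · intro b _ hb
    refine if_neg fun h => hb ?_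
    simpa using DFunLike.congr_fun h 1
  · simp; omega
  · intro a _ ha
    refine Finset.sum_eq_zero fun b _ => if_neg fun h => ha ?_
    simpa using DFunLike.congr_fun h 0
  · simp; omega

theorem isHomogeneous_ternary_sum {F : Type*} [CommSemiring F] (s : ℕ) (c : ℕ → ℕ → F) :
    (∑ i ∈ Finset.range (s + 1), ∑ j ∈ Finset.range (s + 1 - i),
      C (c i j) * X 0 ^ i * X 1 ^ j * X 2 ^ (s - i - j) : MvPolynomial (Fin 3) F).IsHomogeneous s := by
  refine IsHomogeneous.sum _ _ _ fun i hi => IsHomogeneous.sum _ _ _ fun j hj => ?_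
  rw [Finset.mem_range] at hi hj
  have := (((isHomogeneous_C (Fin 3) (c i j)).mul (isHomogeneous_X_pow 0 i)).mul
    (isHomogeneous_X_pow 1 j)).mul (isHomogeneous_X_pow 2 (s - i - j))
  rwa [show 0 + i + j + (s - i - j) = s by omega] at this

theorem sum_dvd_sum_of_pow_eq_mul {F σ : Type*} [Field F] {p v n N s : ℕ} [ExpChar F p]
    (c : ℕ → ℕ → F) (x y : MvPolynomial σ F) {w : F} (hw : w ≠ 0) (hN : N = n * p ^ v)
    (hc : ∀ i j, i + j ≤ s → c i j ^ p ^ v = w * c i j) :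
    (∑ i ∈ Finset.range (s + 1), ∑ j ∈ Finset.range (s + 1 - i),
      C (c i j) * x ^ (i * n) * y ^ (j * n)) ∣
    ∑ i ∈ Finset.range (s + 1), ∑ j ∈ Finset.range (s + 1 - i),
      C (c i j) * x ^ (i * N) * y ^ (j * N) := by
  have hpv : p ^ v ≠ 0 := pow_ne_zero _ (expChar_pos F p).ne'
  refine (dvd_pow_self _ hpv).trans (Dvd.intro (C w⁻¹) ?_)
  simp only [sum_pow_char_pow, Finset.sum_mul]
  refine Finset.sum_congr rfl fun i hi => Finset.sum_congr rfl fun j hj => ?_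
  rw [Finset.mem_range] at hi hj
  have hcw : C (c i j) ^ p ^ v * C w⁻¹ = (C (c i j) : MvPolynomial σ F) := by
    rw [← C_pow, hc i j (by omega), ← C_mul]
    congr 1
    field_simp
  rw [hN, mul_pow, mul_pow, ← pow_mul, ← pow_mul, mul_assoc i, mul_assoc j]
  linear_combination x ^ (i * (n * p ^ v)) * y ^ (j * (n * p ^ v)) * hcw

end MvPolynomial

theorem Nat.mul_pow_sub_one_eq_of_add_sub_one_eq {p h n m v e : ℕ} (hp : p.Prime) (hh : 0 < h)
    (hn : 2 ≤ n) (hm : ¬ p ∣ m) (hnm : n - 1 = m * p ^ v) (he : n + p ^ h - 1 = p ^ e * n) :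
    e = v ∧ n * (p ^ v - 1) = p ^ h - 1 := by
  have hev : e = v := by
    obtain rfl : n = m * p ^ v + 1 := by omega
    have hm0 : 0 < m := Nat.pos_of_ne_zero (by rintro rfl; simp at hm)
    have hp2 := hp.two_le
    have hpv : 0 < p ^ v := by positivity
    have he' : m * p ^ v + p ^ h = p ^ e * (m * p ^ v + 1) := by omega
    have not_dvd (k : ℕ) : ¬ p ^ (k + 1) ∣ p ^ k := fun h => by
      have := (Nat.pow_dvd_pow_iff_le_right hp2).mp h
      omega
    rcases lt_trichotomy e v with hlt | heq | hgt
    · exfalso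
      rcases lt_trichotomy h e with hhe | rfl | hhe
      · refine not_dvd h ((Nat.dvd_add_right ((pow_dvd_pow p (by omega : h + 1 ≤ v)).mul_left m)).mp ?_)
        rw [he']
        exact (pow_dvd_pow p hhe).mul_right _
      · have h1 : m * p ^ v = p ^ h * (m * p ^ v) := by linarith
        have h2 : 1 < p ^ h := Nat.one_lt_pow hh.ne' hp2
        have h3 : 0 < m * p ^ v := by positivity
        nlinarith
      · refine not_dvd e ((Nat.dvd_add_right
          (((pow_dvd_pow p hlt).mul_left m).mul_left (p ^ e))).mp ?_)
        rw [← mul_add_one, ← he']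
        exact dvd_add ((pow_dvd_pow p hlt).mul_left m) (pow_dvd_pow p hhe)
    · exact heq
    · exfalso
      have hdvd : p ^ (v + 1) ∣ m * p ^ v + p ^ h := he' ▸ (pow_dvd_pow p hgt).mul_right _
      rcases lt_trichotomy h v with hhv | rfl | hhv
      · exact not_dvd h ((Nat.dvd_add_right ((pow_dvd_pow p hhv).mul_left m)).mp
          ((pow_dvd_pow p (by omega)).trans hdvd))
      · have h1 : p ^ h < p ^ e := Nat.pow_lt_pow_right hp2 hgt
        nlinarith [Nat.mul_le_mul_left m (Nat.one_le_of_lt hpv)]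
      · rw [Nat.dvd_add_left (pow_dvd_pow p hhv), pow_succ', Nat.mul_dvd_mul_iff_right hpv] at hdvd
        exact hm hdvd
  subst hev
  refine ⟨rfl, ?_⟩
  have : 0 < p ^ h := by have := hp.pos; positivity
  rw [Nat.mul_sub, mul_comm n]
  omega


/-- Theorem 3.3 (algebraic form): the dehomogenized curve polynomial divides `g`
iff `n (p^v - 1) = q - 1` and all coefficient ratios are fixed by `x ↦ x^(p^v)`. -/
theorem stmt_0 (p h s n m v : ℕ) (hp : p.Prime) (hh : 0 < h)
    (hs : 2 ≤ s) (hn : 2 ≤ n)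
    (hv : 1 ≤ v) (hm : ¬ p ∣ m) (hnm : n - 1 = m * p ^ v)
    (hps2 : s = 2 → 5 < p) (hps3 : 3 ≤ s → s ^ 2 < p)
    (F : Type*) [Field F] [Fintype F] (hcard : Fintype.card F = p ^ h)
    (c : ℕ → ℕ → F)
    (hc : ∃ i j, i + j ≤ s ∧ c i j ≠ 0)
    (Fpoly : MvPolynomial (Fin 3) F)
    (hF : Fpoly = ∑ i ∈ Finset.range (s + 1), ∑ j ∈ Finset.range (s + 1 - i),
        C (c i j) * X 0 ^ (i * n) * X 1 ^ (j * n) * X 2 ^ ((s - i - j) * n))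
    (hsmooth : ∀ P : Fin 3 → AlgebraicClosure F,
        eval P (MvPolynomial.map (algebraMap F (AlgebraicClosure F)) Fpoly) = 0 →
        (∀ k : Fin 3, eval P (MvPolynomial.map (algebraMap F (AlgebraicClosure F))
          (pderiv k Fpoly)) = 0) → P = 0) :
    ((∑ i ∈ Finset.range (s + 1), ∑ j ∈ Finset.range (s + 1 - i),
        C (c i j) * X 0 ^ (i * n) * X 1 ^ (j * n) : MvPolynomial (Fin 2) F) ∣
      ∑ i ∈ Finset.range (s + 1), ∑ j ∈ Finset.range (s + 1 - i),
        C (c i j) * X 0 ^ (i * (n + p ^ h - 1)) * X 1 ^ (j * (n + p ^ h - 1))) ↔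
    (n * (p ^ v - 1) = p ^ h - 1 ∧
      ∀ i j k l : ℕ, i + j ≤ s → k + l ≤ s → c k l ≠ 0 →
        (c i j / c k l) ^ p ^ v = c i j / c k l) := by
  have : Fact p.Prime := ⟨hp⟩
  have : CharP F p := charP_of_card_eq_prime_pow hcard
  have : CharP (AlgebraicClosure F) p := charP_of_injective_algebraMap' F p
  constructor
  · intro hdvd
    set Q : MvPolynomial (Fin 3) F := ∑ i ∈ Finset.range (s + 1),
      ∑ j ∈ Finset.range (s + 1 - i), C (c i j) * X 0 ^ i * X 1 ^ j * X 2 ^ (s - i - j) with hQ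
    have hFQ : Fpoly = expand n Q := by
      rw [hF, hQ]
      simp [← pow_mul, mul_comm]
    obtain ⟨e, N, hpN, heN⟩ := Nat.exists_eq_pow_mul_and_not_dvd
      (show n + p ^ h - 1 ≠ 0 by omega) p hp.ne_one
    have hns : IsNonsingularForm (expand n (map (algebraMap F (AlgebraicClosure F)) Q)) := by
      intro P hP hdP
      rw [← map_expand, ← hFQ] at hP hdP
      exact hsmooth P hP fun k => by rw [← pderiv_map]; exact hdP k
    obtain ⟨rfl, w, hw, hcoeff⟩ := hns.eq_of_expand_vanishes (p := p) (e := e) (N := N) (s := s)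
      (by omega) ((isHomogeneous_ternary_sum s c).map _) hn
      (by rwa [Ne, CharP.cast_eq_zero_iff (AlgebraicClosure F) p])
      fun P hP2 hP => by
        rw [eval_expand_map_eq s _ c P hP2] at hP ⊢
        rw [← heN]
        obtain ⟨r, hr⟩ := hdvd
        rw [hr, map_mul, (mul_eq_zero.mp hP).resolve_left (pow_ne_zero _ hP2), zero_mul, mul_zero]
    obtain ⟨rfl, hq⟩ := Nat.mul_pow_sub_one_eq_of_add_sub_one_eq hp hh hn hm hnm heN
    refine ⟨hq, fun i j k l hij hkl hne => (algebraMap F (AlgebraicClosure F)).injective ?_⟩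
    have hpow (i j : ℕ) (hij : i + j ≤ s) : algebraMap F (AlgebraicClosure F) (c i j) ^ p ^ e =
        w * algebraMap F (AlgebraicClosure F) (c i j) := by
      rw [← coeff_ternary_sum c hij, ← coeff_map]
      exact hcoeff _
    rw [map_pow, map_div₀, div_pow, hpow i j hij, hpow k l hkl, mul_div_mul_left _ _ hw]
  · rintro ⟨hnq, hratio⟩
    obtain ⟨k, l, hkl, hne⟩ := hc
    have hN : n + p ^ h - 1 = n * p ^ v := by
      have h1 : 0 < p ^ h := pow_pos hp.pos h
      rw [Nat.mul_sub] at hnq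
      have : n ≤ n * p ^ v := Nat.le_mul_of_pos_right n (pow_pos hp.pos v)
      omega
    refine sum_dvd_sum_of_pow_eq_mul (p := p) (v := v) c (X 0) (X 1)
      (div_ne_zero (pow_ne_zero (p ^ v) hne) hne) hN fun i j hij => ?_
    have := hratio i j k l hij hkl hne
    rw [div_pow, div_eq_div_iff (pow_ne_zero _ hne) hne] at this
    field_simp
    linear_combination this
end

section
/- Let p be a prime, q = p^h, let v be a proper divisor of h (v | h and v < h), and set n = (q−1)/(p^v−1). Let s ≥ 1 and let G ∈ F_{p^v}[x,y,z] be homogeneous of degree s. Assume: (i) every (a,b,c) ∈ F_{p^v}³ \ {(0,0,0)} with G(a,b,c) = 0 satisfies abc ≠ 0; and (ii) 2·#{(a,b,c) ∈ F_{p^v}³ \ {(0,0,0)} : G(a,b,c) = 0} = (p^v−1)·s·(s+p^v−1). Then 2·#{(x,y,z) ∈ F_q³ \ {(0,0,0)} : G(x^n, y^n, z^n) = 0} = (q−1)·sn·(sn+q−1). (Equivalently, the projective plane curve G(x^n,y^n,z^n) = 0 of degree d = sn has exactly d(d+q−1)/2 points rational over F_q, attaining the Stöhr–Voloch bound.) 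-/
open MvPolynomial

/-- In a finite field whose unit group has order `n * m`, every `m`-th root of unity has exactly
`n` roots of order `n`. -/
theorem FiniteField.card_filter_pow_eq {F : Type*} [Field F] [Fintype F] [DecidableEq F] {n m : ℕ}
    (hnm : n * m = Fintype.card F - 1) {a : F} (ha : a ^ m = 1) :
    (Finset.univ.filter fun x : F => x ^ n = a).card = n := by
  have hpos : 0 < n * m := by
    have := Fintype.one_lt_card (α := F)
    omega
  have hn : 0 < n := Nat.pos_of_mul_pos_right hpos
  have hm : 0 < m := Nat.pos_of_mul_pos_left hpos
  obtain ⟨g, hg⟩ := IsCyclic.exists_generator (α := Fˣ)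
  have hord : orderOf g = n * m := by
    rw [orderOf_eq_card_of_forall_mem_zpowers hg, Nat.card_eq_fintype_card, Fintype.card_units, hnm]
  have hprim : IsPrimitiveRoot (g : F) (n * m) :=
    IsPrimitiveRoot.coe_units_iff.mpr (hord ▸ IsPrimitiveRoot.orderOf g)
  have : NeZero (n * m) := ⟨hpos.ne'⟩
  have hζ : IsPrimitiveRoot ((g : F) ^ m) n := hprim.pow hpos (mul_comm n m)
  have ha0 : a ≠ 0 := by
    rintro rfl
    simp [hm.ne'] at ha
  have hex : ∃ α : F, α ^ n = a := by
    obtain ⟨k, -, hk⟩ := hprim.eq_pow_of_pow_eq_one (ξ := a) (by rw [mul_comm, pow_mul, ha, one_pow])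
    rw [← hk, ← pow_mul] at ha
    obtain ⟨j, rfl⟩ := Nat.dvd_of_mul_dvd_mul_right hm (hprim.dvd_of_pow_eq_one _ ha)
    exact ⟨(g : F) ^ j, by rw [← hk, ← pow_mul, mul_comm]⟩
  have hset : (Finset.univ.filter fun x : F => x ^ n = a) = (Polynomial.nthRoots n a).toFinset := by
    ext x
    simp [Polynomial.mem_nthRoots hn]
  rw [hset, Multiset.toFinset_card_of_nodup (hζ.nthRoots_nodup ha0), hζ.card_nthRoots, if_pos hex]

/-- Theorem 3.5: if the degree-`s` curve `G = 0` over `F_{p^v}` attains the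
Stöhr–Voloch bound with no rational point on the coordinate triangle, then the
curve `G(x^n, y^n, z^n) = 0` of degree `sn` attains the Stöhr–Voloch bound over `F_q`. -/
theorem stmt_1 (p h v s n : ℕ) (hp : p.Prime) (hv : 0 < v) (hvh : v ∣ h) (hvlt : v < h)
    (hn : n * (p ^ v - 1) = p ^ h - 1) (hs : 1 ≤ s)
    (F : Type*) [Field F] [Fintype F] (hcard : Fintype.card F = p ^ h)
    (G : MvPolynomial (Fin 3) F)
    (hGcoeff : ∀ d, (G.coeff d) ^ p ^ v = G.coeff d)
    (hhom : G.IsHomogeneous s)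
    (h1 : ∀ a b c : F, a ^ p ^ v = a → b ^ p ^ v = b → c ^ p ^ v = c →
        (a, b, c) ≠ (0, 0, 0) → eval ![a, b, c] G = 0 → a * b * c ≠ 0)
    (h2 : 2 * Set.ncard {t : F × F × F | t ≠ (0, 0, 0) ∧ t.1 ^ p ^ v = t.1 ∧
        t.2.1 ^ p ^ v = t.2.1 ∧ t.2.2 ^ p ^ v = t.2.2 ∧
        eval ![t.1, t.2.1, t.2.2] G = 0} = (p ^ v - 1) * s * (s + p ^ v - 1)) :
    2 * Set.ncard {t : F × F × F | t ≠ (0, 0, 0) ∧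
        eval ![t.1 ^ n, t.2.1 ^ n, t.2.2 ^ n] G = 0} =
      (p ^ h - 1) * (s * n) * (s * n + p ^ h - 1) := by
  classical
  have hP : 0 < p ^ v := pow_pos hp.pos v
  have hnm : n * (p ^ v - 1) = Fintype.card F - 1 := by rw [hn, hcard]
  have hn0 : n ≠ 0 := by
    rintro rfl
    have := Fintype.one_lt_card (α := F)
    omega
  have hfrob : ∀ x : F, (x ^ n) ^ p ^ v = x ^ n := fun x => by
    rcases eq_or_ne x 0 with rfl | hx
    · rw [zero_pow hn0, zero_pow hP.ne']
    · obtain ⟨m, hm⟩ : ∃ m, p ^ v = m + 1 := ⟨p ^ v - 1, by omega⟩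
      rw [hm, pow_succ, ← pow_mul, show n * m = Fintype.card F - 1 by rw [← hnm, hm]; simp,
        FiniteField.pow_card_sub_one_eq_one x hx, one_mul]
  have hfib : ∀ a : F, a ^ p ^ v = a → a ≠ 0 →
      (Finset.univ.filter fun x : F => x ^ n = a).card = n := fun a ha ha0 => by
    refine FiniteField.card_filter_pow_eq hnm (mul_right_cancel₀ ha0 ?_)
    rw [← pow_succ, Nat.sub_add_cancel hP, ha, one_mul]
  rw [Set.ncard_eq_toFinset_card'] at h2 ⊢
  set A := Set.toFinset {t : F × F × F | t ≠ (0, 0, 0) ∧ t.1 ^ p ^ v = t.1 ∧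
        t.2.1 ^ p ^ v = t.2.1 ∧ t.2.2 ^ p ^ v = t.2.2 ∧
        eval ![t.1, t.2.1, t.2.2] G = 0} with hA
  set B := Set.toFinset {t : F × F × F | t ≠ (0, 0, 0) ∧
        eval ![t.1 ^ n, t.2.1 ^ n, t.2.2 ^ n] G = 0} with hB
  let f : F × F × F → F × F × F := fun t => (t.1 ^ n, t.2.1 ^ n, t.2.2 ^ n)
  have hmaps : ∀ t ∈ B, f t ∈ A := by
    rintro ⟨x, y, z⟩ ht
    simp only [hB, Set.mem_toFinset, Set.mem_ofPred_eq] at ht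
    simp only [hA, f, Set.mem_toFinset, Set.mem_ofPred_eq]
    refine ⟨fun h0 => ht.1 ?_, hfrob x, hfrob y, hfrob z, ht.2⟩
    simpa [hn0] using h0
  have hcardfib : ∀ t ∈ A, (B.filter fun u => f u = t).card = n * (n * n) := by
    rintro ⟨a, b, c⟩ ht
    simp only [hA, Set.mem_toFinset, Set.mem_ofPred_eq] at ht
    obtain ⟨h0, ha, hb, hc, hG⟩ := ht
    have habc := h1 a b c ha hb hc h0 hG
    have ha0 : a ≠ 0 := left_ne_zero_of_mul (left_ne_zero_of_mul habc)
    have hb0 : b ≠ 0 := right_ne_zero_of_mul (left_ne_zero_of_mul habc)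
    have hc0 : c ≠ 0 := right_ne_zero_of_mul habc
    have hprod : (B.filter fun u => f u = (a, b, c)) =
        (Finset.univ.filter fun x : F => x ^ n = a) ×ˢ
          (Finset.univ.filter fun x : F => x ^ n = b) ×ˢ
            (Finset.univ.filter fun x : F => x ^ n = c) := by
      ext ⟨x, y, z⟩
      simp only [hB, f, Finset.mem_filter, Set.mem_toFinset, Set.mem_ofPred_eq, Finset.mem_product,
        Finset.mem_univ, true_and, Prod.mk.injEq]
      refine ⟨fun h => h.2, fun h => ⟨⟨?_, ?_⟩, h⟩⟩
      · rintro ⟨rfl, -⟩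
        exact ha0 (by rw [← h.1, zero_pow hn0])
      · rw [h.1, h.2.1, h.2.2, hG]
    rw [hprod, Finset.card_product, Finset.card_product, hfib a ha ha0, hfib b hb hb0,
      hfib c hc hc0]
  have hBA : B.card = A.card * (n * (n * n)) := by
    rw [Finset.card_eq_sum_card_fiberwise hmaps, Finset.sum_congr rfl hcardfib, Finset.sum_const,
      smul_eq_mul]
  have hq : 0 < p ^ h := pow_pos hp.pos h
  rw [hBA, ← mul_assoc, h2, Nat.add_sub_assoc hP, Nat.add_sub_assoc hq, ← hn]
  ring
end

section
/- Let p be a prime, q = p^h, let v be a divisor of h with v < h, and set n = (q−1)/(p^v−1). Let G ∈ F_{p^v}[x,y,z] be a polynomial such that every (a,b,c) ∈ F_{p^v}³ \ {(0,0,0)} with G(a,b,c) = 0 satisfies abc ≠ 0. Then #{(x,y,z) ∈ F_q³ \ {(0,0,0)} : G(x^n, y^n, z^n) = 0} = n³ · #{(a,b,c) ∈ F_{p^v}³ \ {(0,0,0)} : G(a,b,c) = 0}. (Fiber-counting lemma underlying Theorems 3.5 and 5.1: the map (x,y,z) ↦ (x^n,y^n,z^n) sends F_q-points onto F_{p^v}-points,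 with all fibers of size n³ because the norm map t ↦ t^n from F_q* onto F_{p^v}* has fibers of size n.) -/
open MvPolynomial

section NormFibers

variable {F : Type*} [Field F] [Fintype F]

/-- If `n * m` is the order of `Fˣ`, every root of `X ^ m - 1` in `Fˣ` has exactly `n`
`n`-th roots. -/
theorem card_units_pow_eq_of_mul_eq [DecidableEq F] {n m : ℕ} (hnm : n * m = Fintype.card F - 1)
    {u : Fˣ} (hu : u ^ m = 1) : (Finset.univ.filter fun t : Fˣ => t ^ n = u).card = n := by
  have hc : Nat.card Fˣ = n * m := by
    rw [Nat.card_eq_fintype_card, Fintype.card_units, hnm]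
  have hpos : 0 < n * m := hc ▸ Nat.card_pos
  have hn : 0 < n := pos_of_mul_pos_left hpos (Nat.zero_le m)
  have hrange : (powMonoidHom n : Fˣ →* Fˣ).range = (powMonoidHom m : Fˣ →* Fˣ).ker := by
    refine Subgroup.eq_of_le_of_card_ge ?_ ?_
    · rintro _ ⟨t, rfl⟩
      rw [MonoidHom.mem_ker, powMonoidHom_apply, powMonoidHom_apply, ← pow_mul, ← hc,
        pow_card_eq_one']
    · rw [IsCyclic.card_powMonoidHom_range, IsCyclic.card_powMonoidHom_ker, hc,
        Nat.gcd_mul_left_left, Nat.gcd_mul_right_left, Nat.mul_div_cancel_left _ hn]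
  have hmem : u ∈ Set.range (powMonoidHom n : Fˣ →* Fˣ) := by
    rw [← MonoidHom.coe_range, hrange]
    exact hu
  have hfib := MonoidHom.card_fiber_eq_of_mem_range (powMonoidHom n : Fˣ →* Fˣ) hmem
    ⟨1, map_one _⟩
  have hker := IsCyclic.card_powMonoidHom_ker (G := Fˣ) n
  rw [hc, Nat.gcd_mul_right_left, Nat.card_eq_fintype_card, Fintype.card_subtype] at hker
  simp only [MonoidHom.mem_ker, powMonoidHom_apply] at hker hfib
  rw [hfib, hker]

theorem card_pow_eq_of_pow_eq_self [DecidableEq F] {n r : ℕ} (hr : 0 < r)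
    (hnr : n * (r - 1) = Fintype.card F - 1) {a : F} (ha : a ≠ 0) (har : a ^ r = a) :
    (Finset.univ.filter fun t : F => t ^ n = a).card = n := by
  have hn : n ≠ 0 := by
    rintro rfl
    have := Fintype.one_lt_card (α := F)
    omega
  have hu : (Units.mk0 a ha) ^ (r - 1) = 1 := by
    ext
    have h : a ^ (r - 1) * a = 1 * a := by rw [pow_sub_one_mul hr.ne', har, one_mul]
    simpa using mul_right_cancel₀ ha h
  refine Eq.trans (Finset.card_bij (fun (t : Fˣ) _ => (t : F)) ?_ ?_ ?_).symm
    (card_units_pow_eq_of_mul_eq hnr hu)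
  · intro t ht
    simpa [Units.ext_iff] using ht
  · intro s _ t _ hst
    exact Units.ext hst
  · intro t ht
    simp only [Finset.mem_filter, Finset.mem_univ, true_and] at ht
    have ht0 : t ≠ 0 := by
      rintro rfl
      exact ha (by rw [← ht, zero_pow hn])
    exact ⟨Units.mk0 t ht0, by simp [Units.ext_iff, ht], rfl⟩

theorem pow_pow_eq_pow_of_mul_eq {n r : ℕ} (hr : 0 < r) (hn : n ≠ 0)
    (hnr : n * (r - 1) = Fintype.card F - 1) (t : F) : (t ^ n) ^ r = t ^ n := by
  rcases eq_or_ne t 0 with rfl | ht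
  · rw [zero_pow hn, zero_pow hr.ne']
  · rw [← pow_sub_one_mul hr.ne', ← pow_mul, hnr, FiniteField.pow_card_sub_one_eq_one t ht, one_mul]

end NormFibers

/-- Fiber-counting lemma: if no nonzero `F_{p^v}`-rational zero of `G` lies on the
coordinate triangle, then the `F_q`-points of `G(x^n,y^n,z^n) = 0` are counted by
`n³` times the `F_{p^v}`-points of `G = 0`, where `n = (q-1)/(p^v-1)`. -/
theorem stmt_2 (p h v n : ℕ) (hp : p.Prime) (hv : 0 < v) (hvh : v ∣ h) (hvlt : v < h)
    (hn : n * (p ^ v - 1) = p ^ h - 1)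
    (F : Type*) [Field F] [Fintype F] (hcard : Fintype.card F = p ^ h)
    (G : MvPolynomial (Fin 3) F)
    (hGcoeff : ∀ d, (G.coeff d) ^ p ^ v = G.coeff d)
    (h1 : ∀ a b c : F, a ^ p ^ v = a → b ^ p ^ v = b → c ^ p ^ v = c →
        (a, b, c) ≠ (0, 0, 0) → eval ![a, b, c] G = 0 → a * b * c ≠ 0) :
    Set.ncard {t : F × F × F | t ≠ (0, 0, 0) ∧
        eval ![t.1 ^ n, t.2.1 ^ n, t.2.2 ^ n] G = 0} =
      n ^ 3 * Set.ncard {t : F × F × F | t ≠ (0, 0, 0) ∧ t.1 ^ p ^ v = t.1 ∧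
        t.2.1 ^ p ^ v = t.2.1 ∧ t.2.2 ^ p ^ v = t.2.2 ∧
        eval ![t.1, t.2.1, t.2.2] G = 0} := by
  classical
  have hr : 0 < p ^ v := pow_pos hp.pos v
  rw [← hcard] at hn
  have hn0 : n ≠ 0 := by
    rintro rfl
    have := Fintype.one_lt_card (α := F)
    omega
  rw [Set.ncard_eq_toFinset_card', Set.ncard_eq_toFinset_card']
  rw [Finset.card_eq_sum_card_fiberwise (f := fun t : F × F × F => (t.1 ^ n, t.2.1 ^ n, t.2.2 ^ n))
    (t := Set.toFinset {t : F × F × F | t ≠ (0, 0, 0) ∧ t.1 ^ p ^ v = t.1 ∧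
        t.2.1 ^ p ^ v = t.2.1 ∧ t.2.2 ^ p ^ v = t.2.2 ∧ eval ![t.1, t.2.1, t.2.2] G = 0})]
  · rw [Finset.sum_const_nat (m := n ^ 3), mul_comm]
    rintro ⟨a, b, c⟩ habc
    simp only [Set.mem_toFinset, Set.mem_ofPred_eq] at habc
    obtain ⟨h0, ha, hb, hc, hG⟩ := habc
    have hne := h1 a b c ha hb hc h0 hG
    have ha0 : a ≠ 0 := left_ne_zero_of_mul (left_ne_zero_of_mul hne)
    have hb0 : b ≠ 0 := right_ne_zero_of_mul (left_ne_zero_of_mul hne)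
    have hc0 : c ≠ 0 := right_ne_zero_of_mul hne
    calc
      _ = ((Finset.univ.filter fun t : F => t ^ n = a) ×ˢ
            (Finset.univ.filter fun t : F => t ^ n = b) ×ˢ
            (Finset.univ.filter fun t : F => t ^ n = c)).card := by
        congr 1
        ext ⟨x, y, z⟩
        simp only [Finset.mem_filter, Set.mem_toFinset, Set.mem_ofPred_eq, Prod.mk.injEq,
          Finset.mem_product, Finset.mem_univ, true_and, ne_eq]
        refine ⟨fun h => h.2, ?_⟩
        rintro ⟨rfl, rfl, rfl⟩
        refine ⟨⟨?_, hG⟩, rfl, rfl, rfl⟩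
        rintro ⟨rfl, -, -⟩
        exact ha0 (zero_pow hn0)
      _ = n ^ 3 := by
        rw [Finset.card_product, Finset.card_product, card_pow_eq_of_pow_eq_self hr hn ha0 ha,
          card_pow_eq_of_pow_eq_self hr hn hb0 hb, card_pow_eq_of_pow_eq_self hr hn hc0 hc]
        ring
  · rintro ⟨x, y, z⟩ ht
    simp only [Set.coe_toFinset, Set.mem_ofPred_eq] at ht ⊢
    refine ⟨?_, pow_pow_eq_pow_of_mul_eq hr hn0 hn x, pow_pow_eq_pow_of_mul_eq hr hn0 hn y,
      pow_pow_eq_pow_of_mul_eq hr hn0 hn z, ht.2⟩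
    simpa [hn0] using ht.1
end

section
/- Let K be an algebraically closed field of characteristic different from 2, let n ≥ 1 be an integer, and let a₁, a₂, a₃, a₄, a₅, a₆ ∈ K with a₁a₃a₆ ≠ 0, a₂ ≠ 0, and such that the determinant of the 3×3 symmetric matrix [[a₁, a₂/2, a₄/2], [a₂/2, a₃, a₅/2], [a₄/2, a₅/2, a₆]] is nonzero. Then there exists u ∈ K such that a₁u^{2n} + a₄u^{n} + a₆ = 0 and a₂u^{n} + a₅ ≠ 0. (This is the algebraic core of Proposition 4.2: it produces a point P = (u:0:1) of the curve a₁x^{2n}+a₂x^n y^n+a₃y^{2n}+a₄x^n z^n+a₅y^n z^n+a₆z^{2n} = 0 at which the tangent line meets the curve with multiplicity exactly n.) -/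
/-- Algebraic core of Proposition 4.2: there is a root `u` of
`a₁ u^{2n} + a₄ u^n + a₆ = 0` with `a₂ u^n + a₅ ≠ 0`. -/
theorem stmt_3 (K : Type*) [Field K] [IsAlgClosed K] (h2 : (2 : K) ≠ 0)
    (n : ℕ) (hn : 1 ≤ n) (a1 a2 a3 a4 a5 a6 : K)
    (h136 : a1 * a3 * a6 ≠ 0) (ha2 : a2 ≠ 0)
    (hdet : Matrix.det !![a1, a2 / 2, a4 / 2; a2 / 2, a3, a5 / 2; a4 / 2, a5 / 2, a6] ≠ 0) :
    ∃ u : K, a1 * u ^ (2 * n) + a4 * u ^ n + a6 = 0 ∧ a2 * u ^ n + a5 ≠ 0 := by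
  have ha1 : a1 ≠ 0 := left_ne_zero_of_mul (left_ne_zero_of_mul h136)
  have hn0 : 0 < n := hn
  suffices h : ∃ w : K, a1 * w ^ 2 + a4 * w + a6 = 0 ∧ a2 * w + a5 ≠ 0 by
    obtain ⟨w, hw, hw'⟩ := h
    obtain ⟨u, rfl⟩ := IsAlgClosed.exists_pow_nat_eq w hn0
    exact ⟨u, by rw [← hw]; ring, hw'⟩
  by_contra! h
  have : NeZero (2 : K) := ⟨h2⟩
  obtain ⟨s, hs⟩ := IsAlgClosed.exists_pow_nat_eq (discrim a1 a4 a6) two_pos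
  obtain ⟨w, hw⟩ := exists_quadratic_eq_zero ha1 ⟨s, by rw [← hs, sq]⟩
  have hroot : a1 * w ^ 2 + a4 * w + a6 = 0 := by rw [← hw]; ring
  have hroot' : a1 * (-a4 / a1 - w) ^ 2 + a4 * (-a4 / a1 - w) + a6 = 0 := by
    rw [← hroot]; field_simp; ring
  have hline := h w hroot
  have hline' := h _ hroot'
  have heq : w = -a4 / a1 - w := mul_left_cancel₀ ha2 (by linear_combination hline - hline')
  have h4 : a4 = -(2 * a1 * w) := by
    field_simp at heq
    linear_combination heq
  have h5 : a5 = -(a2 * w) := by linear_combination hline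
  have h6 : a6 = a1 * w ^ 2 := by
    rw [h4] at hroot
    linear_combination hroot
  apply hdet
  rw [Matrix.det_fin_three]
  simp only [Matrix.of_apply, Matrix.cons_val, h4, h5, h6]
  field_simp
  ring
end

section
/- Let K be an arbitrary field, let b₁(x), b₂(x) ∈ K[x] be nonconstant polynomials, and let l and m be positive integers. Then y^l − b₁(x) divides y^m − b₂(x) in K[x,y] if and only if l divides m and b₂(x) = b₁(x)^{m/l}. -/
open Polynomial

lemma X_pow_sub_C_dvd_reduction {R : Type*} [CommRing R] (b : R) (l m : ℕ) :
    (X ^ l - C b : R[X]) ∣ X ^ m - C (b ^ (m / l)) * X ^ (m % l) := by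
  have h : (X ^ m - C (b ^ (m / l)) * X ^ (m % l) : R[X]) =
      ((X ^ l) ^ (m / l) - C b ^ (m / l)) * X ^ (m % l) := by
    rw [sub_mul, ← pow_mul, ← pow_add, Nat.div_add_mod, C_pow]
  rw [h]
  exact (sub_dvd_pow_sub_pow _ _ _).mul_right _

/-- Lemma 4.12 (from [FM, Theorem 3.2]): `y^l - b₁(x)` divides `y^m - b₂(x)` in
`K[x][y]` iff `l ∣ m` and `b₂ = b₁^(m/l)`. -/
theorem stmt_4 (K : Type*) [Field K] (b1 b2 : Polynomial K)
    (hb1 : 0 < b1.natDegree) (hb2 : 0 < b2.natDegree)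
    (l m : ℕ) (hl : 0 < l) (hm : 0 < m) :
    ((X ^ l - C b1 : Polynomial (Polynomial K)) ∣ X ^ m - C b2) ↔
      (l ∣ m ∧ b2 = b1 ^ (m / l)) := by
  have hred := X_pow_sub_C_dvd_reduction b1 l m
  constructor
  · intro h
    have hdvd : (X ^ l - C b1 : K[X][X]) ∣ C (b1 ^ (m / l)) * X ^ (m % l) - C b2 := by
      simpa using dvd_sub h hred
    have hzero : C (b1 ^ (m / l)) * X ^ (m % l) - C b2 = (0 : K[X][X]) := by
      by_contra hne
      refine (monic_X_pow_sub_C b1 hl.ne').not_dvd_of_natDegree_lt hne ?_ hdvd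
      rw [natDegree_sub_C, natDegree_X_pow_sub_C]
      exact (natDegree_C_mul_X_pow_le _ _).trans_lt (Nat.mod_lt m hl)
    have hcoeff := congrArg (coeff · 0) hzero
    by_cases hr : m % l = 0
    · refine ⟨Nat.dvd_of_mod_eq_zero hr, ?_⟩
      simp only [hr, pow_zero, mul_one, coeff_sub, coeff_C_zero, coeff_zero] at hcoeff
      exact (sub_eq_zero.mp hcoeff).symm
    · simp only [coeff_sub, coeff_C_mul, coeff_X_pow, coeff_C_zero, coeff_zero,
        if_neg (Ne.symm hr), mul_zero, zero_sub, neg_eq_zero] at hcoeff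
      simp [hcoeff] at hb2
  · rintro ⟨hlm, rfl⟩
    simpa [Nat.mod_eq_zero_of_dvd hlm] using hred
end

section
/- Let p be an odd prime, q = p^h, and let n ≥ 1 be an integer. Let a, b, c ∈ F_q with a ≠ 0 and b ≠ 0. Then the polynomial y^{2n} − a x^{2n} − b x^{n} − c divides the polynomial y^{2n+q−1} − a x^{2n+q−1} − b x^{(2n+q−1)/2} − c in F_q[x,y] if and only if there exists an integer v ≥ 1 such that 2n·(p^v − 1) = q − 1 and a^{p^v} = a, b^{p^v} = b, c^{p^v} = c. (This divisibility is the key computation in Lemma 4.13 characterizing F_q-Frobenius nonclassicality with respect to conics of the curves y^{2n} = a x^{2n} + b x^n + c.) -/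
open Polynomial

theorem eq_one_of_trinomial_pow_eq {F : Type*} [Field F] {u : ℕ} (hu : (u : F) ≠ 0)
    {a b c a' b' c' : F} (ha : a ≠ 0) (hb : b ≠ 0)
    (H : (C a * X ^ 2 + C b * X + C c : F[X]) ^ u = C a' * X ^ (2 * u) + C b' * X ^ u + C c') :
    u = 1 := by
  by_contra h1
  have h0 : u ≠ 0 := by rintro rfl; simp at hu
  have hs : u - 1 ≠ 0 := by omega
  have hs' : 2 * u - 1 ≠ 0 := by omega
  have hc : c = 0 := by
    have := congrArg (fun f => eval 0 (derivative f)) H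
    simpa [derivative_pow, hs, hs', hu, hb] using this
  subst hc
  have hc' : c' = 0 := by
    have := congrArg (eval 0) H
    simpa [h0, eq_comm] using this
  subst hc'
  have H' : (C a * X + C b : F[X]) ^ u = C a' * X ^ u + C b' := by
    apply mul_left_cancel₀ (pow_ne_zero u (X_ne_zero (R := F)))
    rw [← mul_pow]
    simp only [C_0, add_zero] at H
    rw [show X * (C a * X + C b) = C a * X ^ 2 + C b * X by ring, H]
    ring
  have := congrArg (fun f => eval 0 (derivative f)) H'
  simp [derivative_pow, hs, hu, hb, ha] at this

theorem trinomial_pow_char_pow {R : Type*} [CommRing R] (p : ℕ) [Fact p.Prime] [CharP R p]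
    (a b c : R) (k s : ℕ) :
    (C a * X ^ (2 * k) + C b * X ^ k + C c : R[X]) ^ p ^ s =
      C (a ^ p ^ s) * X ^ (2 * k * p ^ s) + C (b ^ p ^ s) * X ^ (k * p ^ s) + C (c ^ p ^ s) := by
  simp only [add_pow_char_pow, mul_pow, ← C_pow, ← pow_mul]

theorem trinomial_coeffs_eq {R : Type*} [CommRing R] {a b c a' b' c' : R} {k : ℕ} (hk : k ≠ 0)
    (H : (C a * X ^ (2 * k) + C b * X ^ k + C c : R[X]) =
      C a' * X ^ (2 * k) + C b' * X ^ k + C c') : a = a' ∧ b = b' ∧ c = c' := by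
  have e1 : ¬ k = 2 * k := by omega
  have e2 : ¬ 2 * k = k := by omega
  have h2 := congrArg (fun f => coeff f (2 * k)) H
  have h1 := congrArg (fun f => coeff f k) H
  have h0 := congrArg (fun f => coeff f 0) H
  simp [coeff_X_pow, coeff_C, hk, e1, e2, hk.symm] at h2 h1 h0
  exact ⟨h2, h1, h0⟩

theorem exists_eq_char_pow_of_trinomial_pow_eq {F : Type*} [Field F] (p : ℕ) [Fact p.Prime]
    [CharP F p] {a b c : F} (ha : a ≠ 0) (hb : b ≠ 0) {m : ℕ} (hm : m ≠ 0)
    (H : (C a * X ^ 2 + C b * X + C c : F[X]) ^ m = C a * X ^ (2 * m) + C b * X ^ m + C c) :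
    ∃ s, m = p ^ s ∧ a ^ p ^ s = a ∧ b ^ p ^ s = b ∧ c ^ p ^ s = c := by
  have hp : p.Prime := Fact.out
  obtain ⟨s, u, hpu, rfl⟩ := Nat.exists_eq_pow_mul_and_not_dvd hm p hp.ne_one
  have hps : 0 < p ^ s := pow_pos hp.pos s
  have hu : (u : F) ≠ 0 := by rwa [Ne, CharP.cast_eq_zero_iff F p]
  have hone : u = 1 := by
    refine eq_one_of_trinomial_pow_eq (a := a ^ p ^ s) (b := b ^ p ^ s) (c := c ^ p ^ s)
      (a' := a) (b' := b) (c' := c) hu (pow_ne_zero _ ha) (pow_ne_zero _ hb)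
      (expand_injective hps ?_)
    have := trinomial_pow_char_pow p a b c 1 s
    simp only [mul_one, pow_one, one_mul] at this
    rw [pow_mul, this] at H
    simp only [map_pow, map_add, map_mul, expand_C, expand_X, ← pow_mul] at H ⊢
    rw [mul_comm (p ^ s) 2, H]
    ring
  subst hone
  have h2 := trinomial_pow_char_pow p a b c 1 s
  simp only [mul_one, pow_one, one_mul] at H h2
  exact ⟨s, by simp, trinomial_coeffs_eq hps.ne' (h2.symm.trans H)⟩

/-- `X ^ d - C f` divides `X ^ N - C g` exactly when `d` divides `N` and `g = f ^ (N / d)`. -/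
theorem X_pow_sub_C_dvd_X_pow_sub_C_iff {R : Type*} [CommRing R] [IsDomain R] {d N : ℕ}
    (hd : 0 < d) {f g : R} (hf : f ≠ 0) :
    (X ^ d - C f : R[X]) ∣ X ^ N - C g ↔ ∃ m, N = d * m ∧ f ^ m = g := by
  have key (m : ℕ) : (X ^ d - C f : R[X]) ∣ X ^ (d * m) - C (f ^ m) := by
    rw [pow_mul, C_pow]
    exact sub_dvd_pow_sub_pow _ _ m
  constructor
  · intro H
    have hr : N % d < d := Nat.mod_lt N hd
    have hdvd : (X ^ d - C f : R[X]) ∣ C (f ^ (N / d)) * X ^ (N % d) - C g := by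
      have h2 := dvd_sub H ((key (N / d)).mul_right (X ^ (N % d)))
      convert h2 using 1
      rw [sub_mul, ← pow_add, Nat.div_add_mod]
      ring
    have hzero : C (f ^ (N / d)) * X ^ (N % d) - C g = 0 := by
      by_contra hne
      refine (monic_X_pow_sub_C f hd.ne').not_dvd_of_natDegree_lt hne ?_ hdvd
      rw [natDegree_X_pow_sub_C]
      refine lt_of_le_of_lt (natDegree_sub_le _ _) (max_lt ?_ (by simpa using hd))
      exact (natDegree_C_mul_X_pow_le _ _).trans_lt hr
    have hmod : N % d = 0 := by
      by_contra hne
      have := congrArg (fun f => coeff f (N % d)) hzero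
      rw [coeff_sub, coeff_C_mul_X_pow, coeff_C_of_ne_zero hne] at this
      simp [hf] at this
    refine ⟨N / d, (Nat.mul_div_cancel' (Nat.dvd_of_mod_eq_zero hmod)).symm, ?_⟩
    rw [hmod, pow_zero, mul_one, ← C_sub, C_eq_zero] at hzero
    exact sub_eq_zero.mp hzero
  · rintro ⟨m, rfl, rfl⟩
    exact key m

/-- Key computation in Lemma 4.13: divisibility of `y^{2n+q-1} - a x^{2n+q-1} - b x^{(2n+q-1)/2} - c`
by `y^{2n} - a x^{2n} - b x^n - c` in `F_q[x][y]` characterizes Frobenius nonclassicality. -/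
theorem stmt_5 (p h n : ℕ) (hp : p.Prime) (hodd : p ≠ 2) (hh : 0 < h) (hn : 1 ≤ n)
    (F : Type*) [Field F] [Fintype F] (hcard : Fintype.card F = p ^ h)
    (a b c : F) (ha : a ≠ 0) (hb : b ≠ 0) :
    ((X ^ (2 * n) - C (C a * X ^ (2 * n) + C b * X ^ n + C c) :
        Polynomial (Polynomial F)) ∣
      X ^ (2 * n + p ^ h - 1) -
        C (C a * X ^ (2 * n + p ^ h - 1) + C b * X ^ ((2 * n + p ^ h - 1) / 2) + C c)) ↔
    ∃ v : ℕ, 1 ≤ v ∧ 2 * n * (p ^ v - 1) = p ^ h - 1 ∧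
      a ^ p ^ v = a ∧ b ^ p ^ v = b ∧ c ^ p ^ v = c := by
  have : Fact p.Prime := ⟨hp⟩
  have : CharP F p := charP_of_card_eq_prime_pow hcard
  have hq : 1 < p ^ h := Nat.one_lt_pow hh.ne' hp.one_lt
  have hf : (C a * X ^ (2 * n) + C b * X ^ n + C c : F[X]) ≠ 0 := by
    intro H
    exact ha (trinomial_coeffs_eq (a' := 0) (b' := 0) (c' := 0) (by omega : n ≠ 0)
      (H.trans (by simp))).1
  have half (m : ℕ) : 2 * n * m / 2 = n * m := by
    rw [mul_assoc, Nat.mul_div_cancel_left _ two_pos]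
  rw [X_pow_sub_C_dvd_X_pow_sub_C_iff (by omega) hf]
  constructor
  · rintro ⟨m, hN, H⟩
    have hm : m ≠ 0 := by rintro rfl; omega
    rw [hN, half] at H
    obtain ⟨s, rfl, habc⟩ := exists_eq_char_pow_of_trinomial_pow_eq (c := c) p ha hb hm (by
      refine expand_injective (show 0 < n by omega) ?_
      simp only [map_pow, map_add, map_mul, expand_C, expand_X, ← pow_mul]
      rw [mul_comm n 2, H]
      ring)
    refine ⟨s, Nat.one_le_iff_ne_zero.mpr ?_, ?_, habc⟩
    · rintro rfl
      rw [pow_zero] at hN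
      omega
    · rw [Nat.mul_sub, mul_one, ← hN]
      omega
  · rintro ⟨v, -, hv, hav, hbv, hcv⟩
    have hN : 2 * n + p ^ h - 1 = 2 * n * p ^ v := by
      have h1 : 2 * n ≤ 2 * n * p ^ v := Nat.le_mul_of_pos_right _ (pow_pos hp.pos v)
      rw [Nat.mul_sub, mul_one] at hv
      omega
    refine ⟨p ^ v, hN, ?_⟩
    rw [trinomial_pow_char_pow, hav, hbv, hcv, hN, half]
end

section
/- Let F be a field of characteristic p ≥ 0, let a, b, c ∈ F with a ≠ 0 and b ≠ 0, and let k ≥ 2 be an integer. If (aX² + bX + c)^k = aX^{2k} + bX^{k} + c holds in the polynomial ring F[X], then p > 0 and there exists an integer v ≥ 1 such that k = p^v, and moreover a^k = a, b^k = b, and c^k = c. -/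
open Polynomial

theorem coeff_quadratic_mul {R : Type*} [CommRing R] (a b c : R) (P : R[X]) (n : ℕ) :
    ((C a * X ^ 2 + C b * X + C c) * P).coeff (n + 2) =
      a * P.coeff n + b * P.coeff (n + 1) + c * P.coeff (n + 2) := by
  rw [add_mul, add_mul, mul_assoc, mul_assoc, coeff_add, coeff_add, coeff_C_mul, coeff_C_mul,
    coeff_C_mul, coeff_X_pow_mul, coeff_X_mul]

theorem natDegree_quadratic_pow_le {R : Type*} [CommRing R] (a b c : R) (m : ℕ) :
    ((C a * X ^ 2 + C b * X + C c) ^ m).natDegree ≤ 2 * m := by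
  rw [mul_comm 2 m]
  exact natDegree_pow_le_of_le m natDegree_quadratic_le

theorem coeff_quadratic_pow_top {R : Type*} [CommRing R] (a b c : R) (m : ℕ) :
    ((C a * X ^ 2 + C b * X + C c) ^ m).coeff (2 * m) = a ^ m := by
  rw [mul_comm 2 m, coeff_pow_of_natDegree_le natDegree_quadratic_le]
  simp

theorem coeff_quadratic_pow_subtop {R : Type*} [CommRing R] (a b c : R) (m : ℕ) :
    ((C a * X ^ 2 + C b * X + C c) ^ (m + 1)).coeff (2 * m + 1) = (m + 1) * a ^ m * b := by
  induction m with
  | zero => simp [coeff_C]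
  | succ m ih =>
    have hdeg : ((C a * X ^ 2 + C b * X + C c) ^ (m + 1)).coeff (2 * m + 1 + 2) = 0 :=
      coeff_eq_zero_of_natDegree_lt
        ((natDegree_quadratic_pow_le a b c (m + 1)).trans_lt (by omega))
    have htop := coeff_quadratic_pow_top a b c (m + 1)
    rw [show 2 * (m + 1) = 2 * m + 1 + 1 by ring] at htop
    rw [pow_succ' _ (m + 1), show 2 * (m + 1) + 1 = 2 * m + 1 + 2 by ring,
      coeff_quadratic_mul, ih, hdeg, htop]
    push_cast
    ring

theorem exists_eq_char_pow_mul_and_quadratic_pow {F : Type*} [Field F] (p : ℕ) [CharP F p]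
    (a b c : F) {k : ℕ} (hk : k ≠ 0) :
    ∃ v m : ℕ, k = p ^ v * m ∧ p ^ v ≠ 0 ∧ (m : F) ≠ 0 ∧
      (C a * X ^ 2 + C b * X + C c : F[X]) ^ p ^ v =
        expand F (p ^ v) (C (a ^ p ^ v) * X ^ 2 + C (b ^ p ^ v) * X + C (c ^ p ^ v)) := by
  rcases CharP.char_is_prime_or_zero F p with hp | rfl
  · have : Fact p.Prime := ⟨hp⟩
    obtain ⟨v, m, hm, rfl⟩ := Nat.exists_eq_pow_mul_and_not_dvd hk p hp.ne_one
    refine ⟨v, m, rfl, pow_ne_zero _ hp.ne_zero, ?_, ?_⟩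
    · rwa [Ne, CharP.cast_eq_zero_iff F p]
    · simp only [add_pow_char_pow, mul_pow, map_add, map_mul, map_pow, expand_C, expand_X]
      ring
  · have : CharZero F := CharP.charP_to_charZero F
    exact ⟨0, k, by simp, by simp, by exact_mod_cast hk, by simp⟩

/-- If `(aX² + bX + c)^k = aX^{2k} + bX^k + c` in `F[X]` with `a, b ≠ 0` and `k ≥ 2`,
then `char F = p > 0`, `k` is a power of `p`, and `a, b, c` are fixed by `x ↦ x^k`. -/
theorem stmt_6 (F : Type*) [Field F] (p : ℕ) [CharP F p]
    (a b c : F) (ha : a ≠ 0) (hb : b ≠ 0) (k : ℕ) (hk : 2 ≤ k)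
    (heq : (C a * X ^ 2 + C b * X + C c : Polynomial F) ^ k =
      C a * X ^ (2 * k) + C b * X ^ k + C c) :
    0 < p ∧ ∃ v : ℕ, 1 ≤ v ∧ k = p ^ v ∧ a ^ k = a ∧ b ^ k = b ∧ c ^ k = c := by
  obtain ⟨v, m, hkm, hq, hm, hpow⟩ :=
    exists_eq_char_pow_mul_and_quadratic_pow p a b c (show k ≠ 0 by omega)
  have hreduced : (C (a ^ p ^ v) * X ^ 2 + C (b ^ p ^ v) * X + C (c ^ p ^ v) : F[X]) ^ m =
      C a * X ^ (2 * m) + C b * X ^ m + C c := by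
    apply expand_injective (Nat.pos_of_ne_zero hq)
    rw [map_pow, ← hpow, ← pow_mul, ← hkm, heq, hkm]
    simp only [map_add, map_mul, map_pow, expand_C, expand_X]
    ring
  have hm1 : m = 1 := by
    obtain _ | _ | n := m
    · simp at hm
    · rfl
    · have h := coeff_quadratic_pow_subtop (a ^ p ^ v) (b ^ p ^ v) (c ^ p ^ v) (n + 1)
      rw [hreduced] at h
      simp only [coeff_add, coeff_C_mul, coeff_X_pow, coeff_C] at h
      rw [if_neg (by omega), if_neg (by omega), if_neg (by omega)] at h
      have hne : ((n + 1 : ℕ) + 1 : F) * (a ^ p ^ v) ^ (n + 1) * b ^ p ^ v ≠ 0 :=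
        mul_ne_zero (mul_ne_zero (by exact_mod_cast hm) (pow_ne_zero _ (pow_ne_zero _ ha)))
          (pow_ne_zero _ hb)
      exact absurd (by simpa using h.symm) hne
  subst hm1
  rw [mul_one] at hkm
  rw [← hkm, pow_one, mul_one, pow_one] at hreduced
  have hv : v ≠ 0 := by
    rintro rfl
    simp at hkm
    omega
  refine ⟨Nat.pos_of_ne_zero ?_, v, Nat.one_le_iff_ne_zero.mpr hv, hkm, ?_, ?_, ?_⟩
  · rintro rfl
    exact hq (zero_pow hv)
  · simpa [coeff_X, coeff_C, -map_pow] using congrArg (coeff · 2) hreduced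
  · simpa [coeff_X, coeff_C, -map_pow] using congrArg (coeff · 1) hreduced
  · simpa [coeff_X, coeff_C, -map_pow] using congrArg (coeff · 0) hreduced
end

section
/- Let p be an odd prime, q = p^h, let v be a proper divisor of h, and set n = (q−1)/(p^v−1). Let a₁, a₂, a₃, a₄, a₅, a₆ ∈ F_{p^v} be such that the homogeneous polynomial F(x,y,z) = a₁x^{2n} + a₂x^n y^n + a₃y^{2n} + a₄x^n z^n + a₅y^n z^n + a₆z^{2n} defines a nonsingular projective plane curve over F_q. Let δ be the nonnegative integer with (p^v−1)·δ = #{(a,b,c) ∈ F_{p^v}³ \ {(0,0,0)} : a₁a² + a₂ab + a₃b² + a₄ac + a₅bc + a₆c² = 0 and abc = 0}. Then #{(x,y,z) ∈ F_q³ \ {(0,0,0)} : F(x,y,z) = 0} = (q−1) · n · ( n(p^v+1) − δ(n−1) ). -/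
open MvPolynomial

theorem exists_not_isSquare_eq_sq_add_mul_sq {K : Type*} [Field K] [Fintype K]
    (hK : ringChar K ≠ 2) {d : K} (hd : d ≠ 0) : ∃ u w : K, ¬ IsSquare (u ^ 2 + d * w ^ 2) := by
  obtain ⟨c, hc⟩ := FiniteField.exists_nonsquare hK
  have h1 : (Polynomial.X ^ 2 - Polynomial.C c : Polynomial K).degree = 2 :=
    Polynomial.degree_X_pow_sub_C (by norm_num) c
  have h2 : (Polynomial.C d * Polynomial.X ^ 2 : Polynomial K).degree = 2 := by
    rw [Polynomial.degree_C_mul_X_pow 2 hd]; rfl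
  obtain ⟨u, w, h⟩ := FiniteField.exists_root_sum_quadratic h1 h2
    (FiniteField.odd_card_of_char_ne_two hK)
  refine ⟨u, w, ?_⟩
  simp only [Polynomial.eval_sub, Polynomial.eval_pow, Polynomial.eval_X, Polynomial.eval_C,
    Polynomial.eval_mul] at h
  rwa [show u ^ 2 + d * w ^ 2 = c by linear_combination h]

/-- The quadratic character sums to zero over the values of a nondegenerate binary
quadratic form. -/
theorem sum_quadraticChar_binary_form {K : Type*} [Field K] [Fintype K] [DecidableEq K]
    (hK : ringChar K ≠ 2) (α β γ : K) (hd : 4 * α * γ - β ^ 2 ≠ 0) :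
    ∑ t : K × K, quadraticChar K (α * t.1 ^ 2 + β * t.1 * t.2 + γ * t.2 ^ 2) = 0 := by
  obtain ⟨u, w, huw⟩ := exists_not_isSquare_eq_sq_add_mul_sq hK hd
  set e := u ^ 2 + (4 * α * γ - β ^ 2) * w ^ 2 with he
  have he0 : e ≠ 0 := fun h ↦ huw (h ▸ IsSquare.zero)
  -- multiplication by `u + w J`, a similitude of the form with multiplier `e`
  let φ : K × K → K × K := fun t ↦
    (u * t.1 + w * (β * t.1 + 2 * γ * t.2), u * t.2 - w * (2 * α * t.1 + β * t.2))
  have hφ : Function.Bijective φ := by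
    refine Finite.injective_iff_bijective.mp fun t t' h ↦ ?_
    obtain ⟨h1, h2⟩ := Prod.mk.inj h
    refine Prod.ext (mul_left_cancel₀ he0 ?_) (mul_left_cancel₀ he0 ?_)
    · linear_combination (u - w * β) * h1 - 2 * w * γ * h2
    · linear_combination (2 * w * α) * h1 + (u + w * β) * h2
  have key := hφ.sum_comp fun t : K × K ↦
    quadraticChar K (α * t.1 ^ 2 + β * t.1 * t.2 + γ * t.2 ^ 2)
  have hmul : ∀ t : K × K, α * (φ t).1 ^ 2 + β * (φ t).1 * (φ t).2 + γ * (φ t).2 ^ 2 =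
      e * (α * t.1 ^ 2 + β * t.1 * t.2 + γ * t.2 ^ 2) := fun t ↦ by
    simp only [φ, he]; ring
  simp only [hmul, map_mul, quadraticChar_neg_one_iff_not_isSquare.mpr huw,
    ← Finset.mul_sum] at key
  linarith

/-- A nondegenerate ternary quadratic form over a finite field with `s` elements has `s ^ 2`
zeros. -/
theorem card_zeros_ternary_form {K : Type*} [Field K] [Fintype K] [DecidableEq K]
    (hK : ringChar K ≠ 2) (a1 a2 a3 a4 a5 a6 : K) (ha1 : a1 ≠ 0)
    (hd : 4 * a1 * a3 * a6 + a2 * a4 * a5 - a1 * a5 ^ 2 - a3 * a4 ^ 2 - a6 * a2 ^ 2 ≠ 0) :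
    (Finset.univ.filter fun t : K × K × K ↦
      a1 * t.1 ^ 2 + a2 * t.1 * t.2.1 + a3 * t.2.1 ^ 2 + a4 * t.1 * t.2.2
          + a5 * t.2.1 * t.2.2 + a6 * t.2.2 ^ 2 = 0).card = Fintype.card K ^ 2 := by
  have h2 : (2 : K) ≠ 0 := Ring.two_ne_zero hK
  have hsum := sum_quadraticChar_binary_form hK (a2 ^ 2 - 4 * a1 * a3)
    (2 * a2 * a4 - 4 * a1 * a5) (a4 ^ 2 - 4 * a1 * a6) (by
      have : (2 * 2 * (2 * 2) * a1 : K) ≠ 0 := by simp [h2, ha1]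
      convert mul_ne_zero this hd using 1
      ring)
  zify
  rw [Finset.card_eq_sum_card_fiberwise (f := Prod.snd) (t := Finset.univ) (by simp)]
  have hfib : ∀ b : K × K, (((Finset.univ.filter fun t : K × K × K ↦
      a1 * t.1 ^ 2 + a2 * t.1 * t.2.1 + a3 * t.2.1 ^ 2 + a4 * t.1 * t.2.2
          + a5 * t.2.1 * t.2.2 + a6 * t.2.2 ^ 2 = 0).filter fun t ↦ t.2 = b).card : ℤ) =
      quadraticChar K ((a2 ^ 2 - 4 * a1 * a3) * b.1 ^ 2
        + (2 * a2 * a4 - 4 * a1 * a5) * b.1 * b.2 + (a4 ^ 2 - 4 * a1 * a6) * b.2 ^ 2) + 1 := by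
    rintro ⟨y, z⟩
    rw [← quadraticChar_card_sqrts hK, Nat.cast_inj]
    refine Finset.card_bij' (fun t _ ↦ 2 * a1 * t.1 + a2 * y + a4 * z)
      (fun x _ ↦ ((x - a2 * y - a4 * z) / (2 * a1), y, z)) ?_ ?_ ?_ ?_
    · rintro ⟨x, y', z'⟩ h
      simp only [Finset.mem_filter, Finset.mem_univ, true_and, Prod.mk.injEq] at h
      obtain ⟨h, rfl, rfl⟩ := h
      simp only [Set.mem_toFinset, Set.mem_ofPred_eq]
      linear_combination 4 * a1 * h
    · intro x h
      simp only [Set.mem_toFinset, Set.mem_ofPred_eq] at h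
      simp only [Finset.mem_filter, Finset.mem_univ, true_and, and_true]
      field_simp
      linear_combination h
    · rintro ⟨x, y', z'⟩ h
      simp only [Finset.mem_filter, Finset.mem_univ, true_and, Prod.mk.injEq] at h
      obtain ⟨h, rfl, rfl⟩ := h
      simp only [Prod.mk.injEq, and_true]
      field_simp
      ring
    · intro x h
      field_simp
      ring
  push_cast
  simp only [hfib, Finset.sum_add_distrib, hsum]
  simp [sq]

/-- If `n * m = |R| - 1`, the `n`-th power map is `n`-to-one onto the `m`-th roots of unity,
of which there are `m`. -/
theorem card_pow_fiber_of_mul_eq {R : Type*} [Field R] [Fintype R] [DecidableEq R] {n m : ℕ}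
    (hnm : n * m = Fintype.card R - 1) :
    (Finset.univ.filter fun y : R ↦ y ^ m = 1).card = m ∧
    ∀ y : R, y ^ m = 1 → (Finset.univ.filter fun x : R ↦ x ^ n = y).card = n := by
  have hpos : 0 < n * m := by have := Fintype.one_lt_card (α := R); omega
  have hn : 0 < n := Nat.pos_of_mul_pos_right hpos
  have hm : 0 < m := Nat.pos_of_mul_pos_left hpos
  have hle : ∀ (k : ℕ) (y : R), 0 < k →
      (Finset.univ.filter fun x : R ↦ x ^ k = y).card ≤ k := by
    intro k y hk
    have : (Finset.univ.filter fun x : R ↦ x ^ k = y) = (Polynomial.nthRoots k y).toFinset := by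
      ext x; simp [Polynomial.mem_nthRoots hk]
    rw [this]
    exact (Multiset.toFinset_card_le _).trans (Polynomial.card_nthRoots k y)
  have hmaps : Set.MapsTo (fun x : R ↦ x ^ n) (Finset.univ.erase 0 : Finset R)
      (Finset.univ.filter fun y : R ↦ y ^ m = 1 : Finset R) := by
    intro x hx
    simp only [Finset.coe_erase, Finset.coe_univ, Set.mem_sdiff, Set.mem_univ,
      Set.mem_singleton_iff, true_and] at hx
    simp [← pow_mul, hnm, FiniteField.pow_card_sub_one_eq_one x hx]
  have hsum := Finset.card_eq_sum_card_fiberwise hmaps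
  have hfib : ∀ y ∈ (Finset.univ.filter fun y : R ↦ y ^ m = 1),
      ((Finset.univ.erase 0 : Finset R).filter fun x ↦ x ^ n = y) =
        Finset.univ.filter fun x : R ↦ x ^ n = y := by
    intro y hy
    ext x
    simp only [Finset.mem_filter, Finset.mem_erase, Finset.mem_univ, and_true, true_and,
      and_iff_right_iff_imp] at hy ⊢
    rintro rfl rfl
    simp [hn.ne', hm.ne'] at hy
  rw [Finset.sum_congr rfl fun y hy ↦ congrArg Finset.card (hfib y hy),
    Finset.card_erase_of_mem (Finset.mem_univ _), Finset.card_univ, ← hnm] at hsum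
  have hT := hle m 1 hm
  have hs := Finset.sum_le_card_nsmul (Finset.univ.filter fun y : R ↦ y ^ m = 1) _ n
    fun y _ ↦ hle n y hn
  rw [← hsum, smul_eq_mul, mul_comm] at hs
  have hcard := hT.antisymm (Nat.le_of_mul_le_mul_right hs hn)
  refine ⟨hcard, fun y hy ↦ ?_⟩
  refine (Finset.sum_eq_sum_iff_of_le (s := Finset.univ.filter fun y : R ↦ y ^ m = 1)
    (f := fun y ↦ (Finset.univ.filter fun x : R ↦ x ^ n = y).card) (g := fun _ ↦ n)
    fun y _ ↦ hle n y hn).mp ?_ y (by simpa using hy)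
  rw [← hsum, Finset.sum_const, hcard, smul_eq_mul, mul_comm]

/-- A singular zero `(A, B, C)` of the quadratic form, or a coordinate vertex lying on it, gives a
singular zero of the form obtained by substituting `n`-th powers. -/
theorem nondegenerate_of_smooth {F : Type*} [Field F] (h2 : (2 : F) ≠ 0) {n : ℕ} (hn : 2 ≤ n)
    (a1 a2 a3 a4 a5 a6 : F)
    (hsmooth : ∀ P : Fin 3 → AlgebraicClosure F,
        eval P (MvPolynomial.map (algebraMap F (AlgebraicClosure F))
          (C a1 * X 0 ^ (2 * n) + C a2 * X 0 ^ n * X 1 ^ n + C a3 * X 1 ^ (2 * n)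
      + C a4 * X 0 ^ n * X 2 ^ n + C a5 * X 1 ^ n * X 2 ^ n + C a6 * X 2 ^ (2 * n))) = 0 →
        (∀ k : Fin 3, eval P (MvPolynomial.map (algebraMap F (AlgebraicClosure F))
          (pderiv k (C a1 * X 0 ^ (2 * n) + C a2 * X 0 ^ n * X 1 ^ n + C a3 * X 1 ^ (2 * n)
      + C a4 * X 0 ^ n * X 2 ^ n + C a5 * X 1 ^ n * X 2 ^ n + C a6 * X 2 ^ (2 * n)))) = 0) →
        P = 0) :
    a1 ≠ 0 ∧ a3 ≠ 0 ∧ a6 ≠ 0 ∧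
    4 * a1 * a3 * a6 + a2 * a4 * a5 - a1 * a5 ^ 2 - a3 * a4 ^ 2 - a6 * a2 ^ 2 ≠ 0 := by
  let i := algebraMap F (AlgebraicClosure F)
  have hn0 : n ≠ 0 := by omega
  have hn1 : n - 1 ≠ 0 := by omega
  have key : ∀ x y z : AlgebraicClosure F,
      i a1 * (x ^ n) ^ 2 + i a2 * x ^ n * y ^ n + i a3 * (y ^ n) ^ 2 + i a4 * x ^ n * z ^ n
        + i a5 * y ^ n * z ^ n + i a6 * (z ^ n) ^ 2 = 0 →
      x ^ (n - 1) * (2 * i a1 * x ^ n + i a2 * y ^ n + i a4 * z ^ n) = 0 →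
      y ^ (n - 1) * (i a2 * x ^ n + 2 * i a3 * y ^ n + i a5 * z ^ n) = 0 →
      z ^ (n - 1) * (i a4 * x ^ n + i a5 * y ^ n + 2 * i a6 * z ^ n) = 0 →
      x = 0 ∧ y = 0 ∧ z = 0 := by
    intro x y z h0 h1 h2 h3
    have h := hsmooth ![x, y, z] (by
      simp [pow_mul']
      exact h0) (by
      intro k
      fin_cases k
      · simp [pow_mul', pderiv_X]
        linear_combination (n : AlgebraicClosure F) * h1
      · simp [pow_mul', pderiv_X]
        linear_combination (n : AlgebraicClosure F) * h2
      · simp [pow_mul', pderiv_X]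
        linear_combination (n : AlgebraicClosure F) * h3)
    exact ⟨congrFun h 0, congrFun h 1, congrFun h 2⟩
  refine ⟨?_, ?_, ?_, fun hd ↦ ?_⟩
  · rintro rfl
    simpa using key 1 0 0 (by simp [hn0]) (by simp [hn0]) (by simp [hn1]) (by simp [hn1])
  · rintro rfl
    simpa using key 0 1 0 (by simp [hn0]) (by simp [hn1]) (by simp [hn0]) (by simp [hn1])
  · rintro rfl
    simpa using key 0 0 1 (by simp [hn0]) (by simp [hn1]) (by simp [hn1]) (by simp [hn0])
  · have hdet : (!![2 * a1, a2, a4; a2, 2 * a3, a5; a4, a5, 2 * a6] : Matrix _ _ F).det = 0 := by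
      rw [Matrix.det_fin_three]
      simp
      linear_combination 2 * hd
    obtain ⟨w, hw0, hw⟩ := Matrix.exists_mulVec_eq_zero_iff.mpr hdet
    have e0 := congrFun hw 0
    have e1 := congrFun hw 1
    have e2 := congrFun hw 2
    simp [Matrix.mulVec, dotProduct, Fin.sum_univ_three] at e0 e1 e2
    have eQ : a1 * w 0 ^ 2 + a2 * w 0 * w 1 + a3 * w 1 ^ 2 + a4 * w 0 * w 2 + a5 * w 1 * w 2
        + a6 * w 2 ^ 2 = 0 := by
      refine (mul_eq_zero_iff_left h2).mp ?_
      linear_combination w 0 * e0 + w 1 * e1 + w 2 * e2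
    obtain ⟨x, hx⟩ := IsAlgClosed.exists_pow_nat_eq (i (w 0)) (Nat.pos_of_ne_zero hn0)
    obtain ⟨y, hy⟩ := IsAlgClosed.exists_pow_nat_eq (i (w 1)) (Nat.pos_of_ne_zero hn0)
    obtain ⟨z, hz⟩ := IsAlgClosed.exists_pow_nat_eq (i (w 2)) (Nat.pos_of_ne_zero hn0)
    have m0 := congrArg i e0
    have m1 := congrArg i e1
    have m2 := congrArg i e2
    have mQ := congrArg i eQ
    simp only [map_add, map_mul, map_pow, map_ofNat, map_zero, ← hx, ← hy, ← hz] at m0 m1 m2 mQ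
    obtain ⟨rfl, rfl, rfl⟩ := key x y z mQ (by rw [m0, mul_zero]) (by rw [m1, mul_zero])
      (by rw [m2, mul_zero])
    rw [zero_pow hn0, eq_comm, map_eq_zero] at hx hy hz
    apply hw0
    ext k
    fin_cases k <;> assumption

/-- The elements of `F` fixed by `x ↦ x ^ s` are the zero element and the roots of unity of order
dividing `s - 1`. -/
theorem pow_eq_self_iff_eq_zero_or {F : Type*} [Field F] {s : ℕ} (hs : 2 ≤ s) (x : F) :
    x ^ s = x ↔ x = 0 ∨ x ^ (s - 1) = 1 := by
  obtain ⟨m, rfl⟩ : ∃ m, s = m + 1 := ⟨s - 1, by omega⟩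
  rcases eq_or_ne x 0 with rfl | hx
  · simp
  · simp [hx, pow_succ]

/-- A nondegenerate ternary quadratic form over the subfield with `p ^ v` elements of `F` has
`(p ^ v) ^ 2` zeros with coordinates in that subfield. -/
theorem card_fixed_zeros_ternary_form {F : Type*} [Field F] [Fintype F] [DecidableEq F] {p v : ℕ}
    [Fact p.Prime] [CharP F p] (hodd : p ≠ 2)
    (hs : (Finset.univ.filter fun x : F ↦ x ^ p ^ v = x).card = p ^ v)
    (a1 a2 a3 a4 a5 a6 : F)
    (ha1 : a1 ^ p ^ v = a1) (ha2 : a2 ^ p ^ v = a2) (ha3 : a3 ^ p ^ v = a3)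
    (ha4 : a4 ^ p ^ v = a4) (ha5 : a5 ^ p ^ v = a5) (ha6 : a6 ^ p ^ v = a6) (h1 : a1 ≠ 0)
    (hd : 4 * a1 * a3 * a6 + a2 * a4 * a5 - a1 * a5 ^ 2 - a3 * a4 ^ 2 - a6 * a2 ^ 2 ≠ 0) :
    (Finset.univ.filter fun t : F × F × F ↦
      (t.1 ^ p ^ v = t.1 ∧ t.2.1 ^ p ^ v = t.2.1 ∧ t.2.2 ^ p ^ v = t.2.2) ∧
      a1 * t.1 ^ 2 + a2 * t.1 * t.2.1 + a3 * t.2.1 ^ 2 + a4 * t.1 * t.2.2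
          + a5 * t.2.1 * t.2.2 + a6 * t.2.2 ^ 2 = 0).card = (p ^ v) ^ 2 := by
  let K : Subfield F := (iterateFrobenius F p v).eqLocusField (RingHom.id F)
  have hK : ∀ x : F, x ∈ K ↔ x ^ p ^ v = x := fun x ↦ by
    rw [← iterateFrobenius_def]; rfl
  have : Fintype K := Fintype.ofFinite K
  have hcard : Fintype.card K = p ^ v := by
    rw [← hs]
    exact Fintype.card_of_subtype _ fun x ↦ by simp [hK]
  have hchar : ringChar K ≠ 2 := by
    have : CharP K p := inferInstance
    rwa [ringChar.eq K p]
  have hcount := card_zeros_ternary_form hchar ⟨a1, (hK _).2 ha1⟩ ⟨a2, (hK _).2 ha2⟩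
    ⟨a3, (hK _).2 ha3⟩ ⟨a4, (hK _).2 ha4⟩ ⟨a5, (hK _).2 ha5⟩ ⟨a6, (hK _).2 ha6⟩
    (fun h ↦ h1 (congrArg Subtype.val h)) (fun h ↦ hd (congrArg Subtype.val h))
  rw [← hcard]
  refine Eq.trans ?_ hcount
  rw [hcard]
  symm
  refine Finset.card_bij (fun t _ ↦ (t.1.1, t.2.1.1, t.2.2.1)) ?_ ?_ ?_
  · rintro ⟨x, y, z⟩ h
    simp only [Finset.mem_filter, Finset.mem_univ, true_and] at h ⊢
    exact ⟨⟨(hK _).1 x.2, (hK _).1 y.2, (hK _).1 z.2⟩, congrArg Subtype.val h⟩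
  · rintro ⟨x, y, z⟩ _ ⟨x', y', z'⟩ _ h
    simpa only [Prod.mk.injEq, ← Subtype.ext_iff] using h
  · rintro ⟨x, y, z⟩ h
    simp only [Finset.mem_filter, Finset.mem_univ, true_and] at h
    obtain ⟨⟨hx, hy, hz⟩, h⟩ := h
    refine ⟨(⟨x, (hK _).2 hx⟩, ⟨y, (hK _).2 hy⟩, ⟨z, (hK _).2 hz⟩), ?_, rfl⟩
    simp only [Finset.mem_filter, Finset.mem_univ, true_and]
    exact Subtype.ext h

/-- Theorem 5.1: exact number of `F_q`-rational points of the Frobenius nonclassical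
curve `a₁x^{2n} + a₂x^n y^n + a₃y^{2n} + a₄x^n z^n + a₅y^n z^n + a₆z^{2n} = 0`. -/
theorem stmt_7 (p h v n δ : ℕ) (hp : p.Prime) (hodd : p ≠ 2)
    (hv : 0 < v) (hvh : v ∣ h) (hvlt : v < h)
    (hn : n * (p ^ v - 1) = p ^ h - 1)
    (F : Type*) [Field F] [Fintype F] (hcard : Fintype.card F = p ^ h)
    (a1 a2 a3 a4 a5 a6 : F)
    (ha1 : a1 ^ p ^ v = a1) (ha2 : a2 ^ p ^ v = a2) (ha3 : a3 ^ p ^ v = a3)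
    (ha4 : a4 ^ p ^ v = a4) (ha5 : a5 ^ p ^ v = a5) (ha6 : a6 ^ p ^ v = a6)
    (Fpoly : MvPolynomial (Fin 3) F)
    (hF : Fpoly = C a1 * X 0 ^ (2 * n) + C a2 * X 0 ^ n * X 1 ^ n + C a3 * X 1 ^ (2 * n)
      + C a4 * X 0 ^ n * X 2 ^ n + C a5 * X 1 ^ n * X 2 ^ n + C a6 * X 2 ^ (2 * n))
    (hsmooth : ∀ P : Fin 3 → AlgebraicClosure F,
        eval P (MvPolynomial.map (algebraMap F (AlgebraicClosure F)) Fpoly) = 0 →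
        (∀ k : Fin 3, eval P (MvPolynomial.map (algebraMap F (AlgebraicClosure F))
          (pderiv k Fpoly)) = 0) → P = 0)
    (hδ : (p ^ v - 1) * δ = Set.ncard {t : F × F × F | t ≠ (0, 0, 0) ∧
        t.1 ^ p ^ v = t.1 ∧ t.2.1 ^ p ^ v = t.2.1 ∧ t.2.2 ^ p ^ v = t.2.2 ∧
        a1 * t.1 ^ 2 + a2 * t.1 * t.2.1 + a3 * t.2.1 ^ 2 + a4 * t.1 * t.2.2
          + a5 * t.2.1 * t.2.2 + a6 * t.2.2 ^ 2 = 0 ∧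
        t.1 * t.2.1 * t.2.2 = 0}) :
    Set.ncard {t : F × F × F | t ≠ (0, 0, 0) ∧
        a1 * t.1 ^ (2 * n) + a2 * t.1 ^ n * t.2.1 ^ n + a3 * t.2.1 ^ (2 * n)
          + a4 * t.1 ^ n * t.2.2 ^ n + a5 * t.2.1 ^ n * t.2.2 ^ n
          + a6 * t.2.2 ^ (2 * n) = 0} =
      (p ^ h - 1) * (n * (n * (p ^ v + 1) - δ * (n - 1))) := by
  subst hF
  have : Fact p.Prime := ⟨hp⟩
  have : CharP F p := charP_of_card_eq_prime_pow hcard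
  classical
  have h2 : (2 : F) ≠ 0 := Ring.two_ne_zero (by rwa [ringChar.eq F p])
  have hs : 2 ≤ p ^ v := hp.two_le.trans (Nat.le_self_pow hv.ne' p)
  have hlt : p ^ v < p ^ h := Nat.pow_lt_pow_right hp.one_lt hvlt
  have hn2 : 2 ≤ n := by
    by_contra! hcon
    have := Nat.mul_le_mul_right (p ^ v - 1) (show n ≤ 1 by omega)
    omega
  have hn0 : n ≠ 0 := by omega
  obtain ⟨h1, h3, h6, hd⟩ := nondegenerate_of_smooth h2 hn2 a1 a2 a3 a4 a5 a6 hsmooth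
  obtain ⟨hroots, hfib⟩ := card_pow_fiber_of_mul_eq (R := F) (hcard ▸ hn)
  have hfix := pow_eq_self_iff_eq_zero_or (F := F) hs
  have hs1 : p ^ v - 1 ≠ 0 := by omega
  have hfixcard : (Finset.univ.filter fun x : F ↦ x ^ p ^ v = x).card = p ^ v := by
    have : (Finset.univ.filter fun x : F ↦ x ^ p ^ v = x) =
        insert 0 (Finset.univ.filter fun x : F ↦ x ^ (p ^ v - 1) = 1) := by
      ext x; simp [hfix]
    rw [this, Finset.card_insert_of_notMem (by simp [hs1]), hroots]
    omega
  have hcount := card_fixed_zeros_ternary_form hodd hfixcard a1 a2 a3 a4 a5 a6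
    ha1 ha2 ha3 ha4 ha5 ha6 h1 hd
  set Q : F × F × F → F := fun t ↦ a1 * t.1 ^ 2 + a2 * t.1 * t.2.1 + a3 * t.2.1 ^ 2
    + a4 * t.1 * t.2.2 + a5 * t.2.1 * t.2.2 + a6 * t.2.2 ^ 2 with hQ
  set S : Finset (F × F × F) := (Finset.univ.filter fun t ↦
    (t.1 ^ p ^ v = t.1 ∧ t.2.1 ^ p ^ v = t.2.1 ∧ t.2.2 ^ p ^ v = t.2.2) ∧ Q t = 0).erase 0
    with hS
  have hScard : S.card = (p ^ v) ^ 2 - 1 := by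
    rw [hS, Finset.card_erase_of_mem, hcount]
    simp [hQ, show p ≠ 0 from hp.ne_zero]
  have hmemS : ∀ t, t ∈ S ↔ t ≠ 0 ∧ (t.1 ^ p ^ v = t.1 ∧ t.2.1 ^ p ^ v = t.2.1 ∧
      t.2.2 ^ p ^ v = t.2.2) ∧ Q t = 0 := fun t ↦ by simp [hS]
  have hZ : (S.filter fun t ↦ t.1 * t.2.1 * t.2.2 = 0).card = (p ^ v - 1) * δ := by
    rw [hδ, ← Set.ncard_coe_finset]
    congr 1
    ext t
    simp only [Finset.coe_filter, hmemS, Set.mem_ofPred_eq, hQ, and_assoc]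
    rfl
  let φ : F × F × F → F × F × F := fun t ↦ (t.1 ^ n, t.2.1 ^ n, t.2.2 ^ n)
  set N : Finset (F × F × F) := Finset.univ.filter fun t ↦ t ≠ 0 ∧ Q (φ t) = 0 with hN
  have hfixpow : ∀ x : F, (x ^ n) ^ p ^ v = x ^ n := by
    intro x
    rw [hfix]
    rcases eq_or_ne x 0 with rfl | hx
    · simp [hn0]
    · right
      rw [← pow_mul, hn, ← hcard, FiniteField.pow_card_sub_one_eq_one x hx]
  have hφ0 : ∀ t, φ t = 0 ↔ t = 0 := by
    rintro ⟨x, y, z⟩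
    simp [φ, Prod.ext_iff, hn0]
  have hmaps : Set.MapsTo φ N S := by
    intro t ht
    simp only [hN, Finset.coe_filter, Finset.mem_univ, true_and, Set.mem_ofPred_eq] at ht
    rw [Finset.mem_coe, hmemS]
    exact ⟨mt (hφ0 t).1 ht.1, ⟨hfixpow _, hfixpow _, hfixpow _⟩, ht.2⟩
  have hzero : (Finset.univ.filter fun x : F ↦ x ^ n = 0).card = 1 := by
    rw [Finset.card_eq_one]
    exact ⟨0, by ext; simp [hn0]⟩
  have hfib' : ∀ y : F, y ^ p ^ v = y → y ≠ 0 →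
      (Finset.univ.filter fun x : F ↦ x ^ n = y).card = n := fun y hy hy0 ↦
    hfib y (((hfix y).1 hy).resolve_left hy0)
  have hfiber : ∀ t ∈ S, (N.filter fun u ↦ φ u = t).card =
      if t.1 * t.2.1 * t.2.2 = 0 then n ^ 2 else n ^ 3 := by
    intro t ht
    obtain ⟨ht0, ⟨hx, hy, hz⟩, hQt⟩ := (hmemS t).1 ht
    have hprod : (N.filter fun u ↦ φ u = t) =
        (Finset.univ.filter fun x : F ↦ x ^ n = t.1) ×ˢ
        (Finset.univ.filter fun x : F ↦ x ^ n = t.2.1) ×ˢ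
        (Finset.univ.filter fun x : F ↦ x ^ n = t.2.2) := by
      ext u
      simp only [hN, Finset.mem_filter, Finset.mem_univ, true_and, Finset.mem_product]
      constructor
      · rintro ⟨-, rfl⟩
        exact ⟨rfl, rfl, rfl⟩
      · rintro ⟨e1, e2, e3⟩
        have : φ u = t := Prod.ext e1 (Prod.ext e2 e3)
        exact ⟨⟨fun h ↦ ht0 (this ▸ (hφ0 u).2 h), this ▸ hQt⟩, this⟩
    rw [hprod, Finset.card_product, Finset.card_product]
    clear hprod
    obtain ⟨x, y, z⟩ := t
    dsimp only at hx hy hz hQt ⊢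
    have hxy : x = 0 → y ≠ 0 := by
      rintro rfl rfl
      exact ht0 (by simpa [hQ, h6] using hQt)
    have hxz : x = 0 → z ≠ 0 := by
      rintro rfl rfl
      exact ht0 (by simpa [hQ, h3] using hQt)
    have hyz : y = 0 → z ≠ 0 := by
      rintro rfl rfl
      exact ht0 (by simpa [hQ, h1] using hQt)
    by_cases hx0 : x = 0
    · subst hx0
      rw [hzero, hfib' y hy (hxy rfl), hfib' z hz (hxz rfl), if_pos (by simp)]
      ring
    by_cases hy0 : y = 0
    · subst hy0
      rw [hzero, hfib' x hx hx0, hfib' z hz (hyz rfl), if_pos (by simp)]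
      ring
    by_cases hz0 : z = 0
    · subst hz0
      rw [hzero, hfib' x hx hx0, hfib' y hy hy0, if_pos (by simp)]
      ring
    rw [hfib' x hx hx0, hfib' y hy hy0, hfib' z hz hz0, if_neg (by simp [hx0, hy0, hz0])]
    ring
  have hNcard : N.card = ((p ^ v - 1) * δ) * n ^ 2 +
      (S.filter fun t ↦ ¬ t.1 * t.2.1 * t.2.2 = 0).card * n ^ 3 := by
    rw [Finset.card_eq_sum_card_fiberwise hmaps, Finset.sum_congr rfl hfiber, Finset.sum_ite,
      Finset.sum_const, Finset.sum_const, hZ, smul_eq_mul, smul_eq_mul]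
  have hsplit := Finset.card_filter_add_card_filter_not (s := S)
    (fun t : F × F × F ↦ t.1 * t.2.1 * t.2.2 = 0)
  rw [hZ, hScard] at hsplit
  have hgoal : {t : F × F × F | t ≠ (0, 0, 0) ∧
        a1 * t.1 ^ (2 * n) + a2 * t.1 ^ n * t.2.1 ^ n + a3 * t.2.1 ^ (2 * n)
          + a4 * t.1 ^ n * t.2.2 ^ n + a5 * t.2.1 ^ n * t.2.2 ^ n
          + a6 * t.2.2 ^ (2 * n) = 0} = (N : Set (F × F × F)) := by
    ext t
    simp only [hN, Finset.coe_filter, Finset.mem_univ, true_and, Set.mem_ofPred_eq, hQ, φ,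
      pow_mul']
    rfl
  rw [hgoal, Set.ncard_coe_finset, hNcard]
  rw [← hn]
  clear_value N S
  generalize (S.filter fun t ↦ ¬ t.1 * t.2.1 * t.2.2 = 0).card = c at *
  obtain ⟨m, hm⟩ : ∃ m, p ^ v = m + 1 := ⟨p ^ v - 1, by omega⟩
  obtain ⟨k, rfl⟩ : ∃ k, n = k + 1 := ⟨n - 1, by omega⟩
  simp only [hm, Nat.add_sub_cancel] at hsplit hs1 ⊢
  have hsplit' : m * δ + c = m * (m + 2) := by
    rw [hsplit, Nat.sub_eq_of_eq_add]
    ring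
  have hδle : δ ≤ m + 2 := Nat.le_of_mul_le_mul_left (by omega) (Nat.pos_of_ne_zero hs1)
  have hle : δ * k ≤ (k + 1) * (m + 1 + 1) := by
    rw [mul_comm]
    exact Nat.mul_le_mul (by omega) hδle
  zify [hle] at hsplit' ⊢
  linear_combination ((k : ℤ) + 1) ^ 3 * hsplit'
end

section
/- Let p be an odd prime, q = p^h, let v be a proper divisor of h such that n := (q−1)/(2(p^v−1)) is an integer. Let a, b, c ∈ F_{p^v} be all nonzero and such that the homogeneous polynomial F(x,y,z) = a x^{2n} + b x^n y^n + c y^{2n} + z^{2n} defines a nonsingular projective plane curve over F_q. Let η = #{ t ∈ F_{p^v} : a t² + b t + c = 0 }. Then #{(x,y,z) ∈ F_q³ \ {(0,0,0)} : F(x,y,z) = 0} = (q−1) · n · ( q + 3 − (2n−1)·η ). -/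
open MvPolynomial

open Finset in
/-- In a finite field whose unit group has order `k * m`, the number of solutions of `x ^ k = w`. -/
theorem card_pow_eq_of_mul_eq {F : Type*} [Field F] [Fintype F] [DecidableEq F] {k m : ℕ}
    (hkm : k * m = Fintype.card F - 1) (w : F) :
    #{x : F | x ^ k = w} = if w = 0 then 1 else if w ^ m = 1 then k else 0 := by
  have hq : 0 < Fintype.card F - 1 := Nat.sub_pos_of_lt Fintype.one_lt_card
  have hk : 0 < k := Nat.pos_of_ne_zero (by rintro rfl; omega)
  have hm : 0 < m := Nat.pos_of_ne_zero (by rintro rfl; omega)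
  split_ifs with hw hwm
  · subst hw
    rw [card_eq_one]
    exact ⟨0, by ext x; simp [hk.ne']⟩
  · obtain ⟨g, hg⟩ := IsCyclic.exists_generator (α := Fˣ)
    have hord : orderOf g = k * m := by
      rw [orderOf_eq_card_of_forall_mem_zpowers hg, Nat.card_eq_fintype_card,
        Fintype.card_units, hkm]
    have hprim : IsPrimitiveRoot (g : F) (k * m) := by
      rw [IsPrimitiveRoot.coe_units_iff, ← hord]
      exact IsPrimitiveRoot.orderOf g
    have hprim' : IsPrimitiveRoot ((g : F) ^ m) k :=
      hprim.pow (Nat.mul_pos hk hm) (mul_comm k m)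
    have hex : ∃ α : F, α ^ k = w := by
      have : NeZero (k * m) := ⟨(Nat.mul_pos hk hm).ne'⟩
      obtain ⟨i, -, hi⟩ := hprim.eq_pow_of_pow_eq_one
        (ξ := w) (by rw [mul_comm, pow_mul, hwm, one_pow])
      have hdvd : k * m ∣ i * m := by
        rw [← hprim.pow_eq_one_iff_dvd, pow_mul, hi, hwm]
      obtain ⟨j, rfl⟩ := Nat.dvd_of_mul_dvd_mul_right hm hdvd
      exact ⟨(g : F) ^ j, by rw [← pow_mul, mul_comm j k, hi]⟩
    have hroots := hprim'.card_nthRoots w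
    rw [if_pos hex] at hroots
    rw [← Multiset.toFinset_card_of_nodup (hprim'.nthRoots_nodup hw)] at hroots
    refine Eq.trans (congrArg card ?_) hroots
    ext x
    simp [Polynomial.mem_nthRoots hk]
  · rw [card_eq_zero, filter_eq_empty_iff]
    rintro x - rfl
    apply hwm
    rw [← pow_mul, hkm]
    exact FiniteField.pow_card_sub_one_eq_one x (by rintro rfl; exact hw (zero_pow hk.ne'))

/-- A nonzero `w` satisfies `w ^ (Q - 1) = 1` exactly when it satisfies `w ^ Q = w`. -/
theorem pow_sub_one_eq_one_iff_pow_eq_self {F : Type*} [Field F] {Q : ℕ} (hQ : 0 < Q) {w : F}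
    (hw : w ≠ 0) : w ^ (Q - 1) = 1 ↔ w ^ Q = w := by
  obtain ⟨m, rfl⟩ : ∃ m, Q = m + 1 := ⟨Q - 1, by omega⟩
  rw [Nat.add_sub_cancel, pow_succ, mul_eq_right₀ hw]

open Finset in
/-- The number of solutions of `-(a s ^ (2 * n) + b s ^ n + c) = r ^ (2 * n)`, where the `2 * n`-th
powers form the subfield fixed by `x ↦ x ^ p ^ v`. -/
theorem sum_card_pow_eq_neg_quadratic {p v n : ℕ} {F : Type*} [Field F] [Fintype F] [DecidableEq F]
    [CharP F p] [Fact p.Prime] (hcard : 2 * n * (p ^ v - 1) = Fintype.card F - 1)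
    {a b c : F} (hb : b ≠ 0) (hc : c ≠ 0)
    (ha' : a ^ p ^ v = a) (hb' : b ^ p ^ v = b) (hc' : c ^ p ^ v = c) :
    ∑ s : F, #{r : F | r ^ (2 * n) = -(a * (s ^ n) ^ 2 + b * s ^ n + c)}
      + 2 * n * (n * #{t : F | t ^ p ^ v = t ∧ a * t ^ 2 + b * t + c = 0}) =
    2 * n + n * #{t : F | t ^ p ^ v = t ∧ a * t ^ 2 + b * t + c = 0}
      + 2 * n * (n * (p ^ v - 1)) := by
  have hQ : 0 < p ^ v := Nat.pow_pos (Nat.Prime.pos Fact.out)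
  have hq : 0 < Fintype.card F - 1 := Nat.sub_pos_of_lt Fintype.one_lt_card
  have hn : n ≠ 0 := by rintro rfl; omega
  set φ : F → ℕ := fun t ↦ #{r : F | r ^ (2 * n) = -(a * t ^ 2 + b * t + c)} with hφ
  have hσ (x : F) : iterateFrobenius F p v x = x ^ p ^ v := iterateFrobenius_def ..
  have hfix_neg (x : F) : (-x) ^ p ^ v = -x ↔ x ^ p ^ v = x := by
    rw [← hσ, ← hσ, map_neg, neg_inj]
  have hexpand (t : F) : (a * t ^ 2 + b * t + c) ^ p ^ v =
      a * (t ^ 2) ^ p ^ v + b * t ^ p ^ v + c := by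
    rw [← hσ, map_add, map_add, map_mul, map_mul, hσ, hσ, hσ, hσ, hσ, ha', hb', hc']
  have hfix (t : F) (ht : t ^ p ^ v = t) :
      (a * t ^ 2 + b * t + c) ^ p ^ v = a * t ^ 2 + b * t + c := by
    rw [hexpand, pow_right_comm, ht]
  have hfix' (t : F) (ht : (t ^ 2) ^ p ^ v = t ^ 2)
      (h : (a * t ^ 2 + b * t + c) ^ p ^ v = a * t ^ 2 + b * t + c) : t ^ p ^ v = t := by
    rw [hexpand, ht] at h
    simpa [hb] using h
  have hφ_eq (t : F) (ht0 : t ≠ 0) : #{s : F | s ^ n = t} * φ t =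
      if t ^ p ^ v = t then (if a * t ^ 2 + b * t + c = 0 then n else n * (2 * n)) else 0 := by
    rw [hφ]
    simp only
    rw [card_pow_eq_of_mul_eq (k := n) (m := 2 * (p ^ v - 1)) (by rw [← hcard]; ring),
      card_pow_eq_of_mul_eq hcard, if_neg ht0, pow_mul]
    have h2 := pow_sub_one_eq_one_iff_pow_eq_self hQ (pow_ne_zero 2 ht0)
    by_cases ht : t ^ p ^ v = t
    · rw [if_pos ht, if_pos (h2.2 (by rw [← pow_mul, mul_comm, pow_mul, ht]))]
      by_cases h0 : a * t ^ 2 + b * t + c = 0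
      · simp [h0]
      · rw [if_neg (neg_ne_zero.2 h0), if_neg h0, if_pos]
        rw [pow_sub_one_eq_one_iff_pow_eq_self hQ (neg_ne_zero.2 h0), hfix_neg]
        exact hfix t ht
    · rw [if_neg ht]
      by_cases ht2 : (t ^ 2) ^ (p ^ v - 1) = 1
      · have hne := mt (hfix' t (h2.1 ht2)) ht
        have h0 : a * t ^ 2 + b * t + c ≠ 0 := by
          intro h0; rw [h0] at hne; exact hne (zero_pow hQ.ne')
        rw [if_neg (neg_ne_zero.2 h0), if_neg (c := (-_) ^ _ = _), mul_zero]
        rwa [pow_sub_one_eq_one_iff_pow_eq_self hQ (neg_ne_zero.2 h0), hfix_neg]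
      · rw [if_neg ht2, zero_mul]
  have hφ_zero : #{s : F | s ^ n = 0} * φ 0 = 2 * n := by
    rw [hφ]
    simp only
    rw [card_pow_eq_of_mul_eq (k := n) (m := 2 * (p ^ v - 1)) (by rw [← hcard]; ring),
      card_pow_eq_of_mul_eq hcard, if_pos rfl]
    have hc0 : -c ≠ 0 := neg_ne_zero.2 hc
    simp [hc, pow_sub_one_eq_one_iff_pow_eq_self hQ hc0, hfix_neg, hc']
  have hsum : ∑ s : F, φ (s ^ n) = ∑ t : F, #{s : F | s ^ n = t} * φ t := by
    rw [← sum_fiberwise univ (fun s : F ↦ s ^ n)]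
    refine sum_congr rfl fun t _ ↦ ?_
    rw [← smul_eq_mul, ← sum_const]
    exact sum_congr rfl fun s hs ↦ by rw [(mem_filter.1 hs).2]
  have hT : #{t ∈ (univ : Finset F).erase 0 | t ^ p ^ v = t} = p ^ v - 1 := by
    have := card_pow_eq_of_mul_eq (k := p ^ v - 1) (m := 2 * n) (by rw [← hcard]; ring) (1 : F)
    rw [if_neg one_ne_zero, one_pow, if_pos rfl] at this
    rw [← this]
    have hQ1 : p ^ v - 1 ≠ 0 := fun h ↦ by rw [h] at hcard; omega
    congr 1
    ext t
    rcases eq_or_ne t 0 with rfl | ht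
    · simp [hQ1]
    · simp [ht, pow_sub_one_eq_one_iff_pow_eq_self hQ ht]
  have hη : #{t : F | t ^ p ^ v = t ∧ a * t ^ 2 + b * t + c = 0} =
      #{t ∈ {t ∈ (univ : Finset F).erase 0 | t ^ p ^ v = t} | a * t ^ 2 + b * t + c = 0} := by
    congr 1
    ext t
    rcases eq_or_ne t 0 with rfl | ht
    · simp [hc]
    · simp [ht]
  have hsplit := card_filter_add_card_filter_not
    (s := {t ∈ (univ : Finset F).erase 0 | t ^ p ^ v = t})
    (fun t ↦ a * t ^ 2 + b * t + c = 0)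
  rw [hT] at hsplit
  rw [hsum, ← add_sum_erase _ _ (mem_univ (0 : F)), hφ_zero,
    sum_congr rfl fun t ht ↦ hφ_eq t (ne_of_mem_erase ht), ← sum_filter, sum_ite, sum_const,
    sum_const, hη, ← hsplit, smul_eq_mul, smul_eq_mul]
  ring

/-- Theorem 5.3: exact number of `F_q`-rational points of the Frobenius nonclassical
curve `a x^{2n} + b x^n y^n + c y^{2n} + z^{2n} = 0` with `n = (q-1)/(2(p^v-1))`. -/
theorem stmt_8 (p h v n : ℕ) (hp : p.Prime) (hodd : p ≠ 2)
    (hv : 0 < v) (hvh : v ∣ h) (hvlt : v < h)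
    (hn : 2 * n * (p ^ v - 1) = p ^ h - 1)
    (F : Type*) [Field F] [Fintype F] (hcard : Fintype.card F = p ^ h)
    (a b c : F) (ha : a ≠ 0) (hb : b ≠ 0) (hc : c ≠ 0)
    (ha' : a ^ p ^ v = a) (hb' : b ^ p ^ v = b) (hc' : c ^ p ^ v = c)
    (Fpoly : MvPolynomial (Fin 3) F)
    (hF : Fpoly = C a * X 0 ^ (2 * n) + C b * X 0 ^ n * X 1 ^ n + C c * X 1 ^ (2 * n)
      + X 2 ^ (2 * n))
    (hsmooth : ∀ P : Fin 3 → AlgebraicClosure F,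
        eval P (MvPolynomial.map (algebraMap F (AlgebraicClosure F)) Fpoly) = 0 →
        (∀ k : Fin 3, eval P (MvPolynomial.map (algebraMap F (AlgebraicClosure F))
          (pderiv k Fpoly)) = 0) → P = 0) :
    Set.ncard {t : F × F × F | t ≠ (0, 0, 0) ∧
        a * t.1 ^ (2 * n) + b * t.1 ^ n * t.2.1 ^ n + c * t.2.1 ^ (2 * n)
          + t.2.2 ^ (2 * n) = 0} =
      (p ^ h - 1) * (n * (p ^ h + 3 -
        (2 * n - 1) * Set.ncard {t : F | t ^ p ^ v = t ∧ a * t ^ 2 + b * t + c = 0})) := by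
  classical
  have : Fact p.Prime := ⟨hp⟩
  have : CharP F p := charP_of_card_eq_prime_pow hcard
  rw [← hcard] at hn ⊢
  have hQ : 0 < p ^ v := Nat.pow_pos hp.pos
  have hq : 0 < Fintype.card F - 1 := Nat.sub_pos_of_lt Fintype.one_lt_card
  have hn0 : n ≠ 0 := by rintro rfl; omega
  have hpow (y : F) (hy : y ≠ 0) : (y ^ (2 * n)) ^ (p ^ v - 1) = 1 := by
    rw [← pow_mul, hn, FiniteField.pow_card_sub_one_eq_one y hy]
  have hN : Set.ncard {t : F × F × F | t ≠ (0, 0, 0) ∧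
        a * t.1 ^ (2 * n) + b * t.1 ^ n * t.2.1 ^ n + c * t.2.1 ^ (2 * n)
          + t.2.2 ^ (2 * n) = 0} + 1 =
      ∑ y : F, ∑ x : F, Finset.card {z : F | z ^ (2 * n) =
        -(a * x ^ (2 * n) + b * x ^ n * y ^ n + c * y ^ (2 * n))} := by
    rw [← Set.ncard_insert_of_notMem (a := ((0, 0, 0) : F × F × F)) (by simp) (Set.toFinite _)]
    rw [Finset.sum_comm]
    simp only [Finset.card_filter]
    rw [← Fintype.sum_prod_type', ← Fintype.sum_prod_type',
      ← Equiv.sum_comp (Equiv.prodAssoc F F F).symm, ← Finset.card_filter,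
      ← Set.ncard_coe_finset]
    congr 1
    ext ⟨x, y, z⟩
    by_cases h : (x, y, z) = ((0, 0, 0) : F × F × F)
    · simp only [Prod.mk.injEq] at h
      obtain ⟨rfl, rfl, rfl⟩ := h
      simp [hn0]
    · simp only [Set.mem_insert_iff, h, false_or, Set.mem_ofPred_eq, ne_eq, not_false_eq_true,
        true_and, Finset.coe_filter, Finset.mem_univ, Equiv.prodAssoc_symm_apply]
      rw [add_comm, add_eq_zero_iff_eq_neg]
  have hyzero : ∑ x : F, Finset.card {z : F | z ^ (2 * n) =
        -(a * x ^ (2 * n) + b * x ^ n * 0 ^ n + c * 0 ^ (2 * n))} =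
      1 + (Fintype.card F - 1) * (2 * n) := by
    rw [← Finset.add_sum_erase _ _ (Finset.mem_univ (0 : F)), Finset.sum_const_nat (m := 2 * n),
      Finset.card_erase_of_mem (Finset.mem_univ _), Finset.card_univ,
      card_pow_eq_of_mul_eq hn, if_pos (by simp [hn0])]
    intro x hx
    have hx0 : x ≠ 0 := Finset.ne_of_mem_erase hx
    have ha0 : -a ≠ 0 := neg_ne_zero.2 ha
    have h1 : -(a * x ^ (2 * n) + b * x ^ n * 0 ^ n + c * 0 ^ (2 * n)) = -a * x ^ (2 * n) := by
      simp [hn0]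
    rw [card_pow_eq_of_mul_eq hn, h1, if_neg (mul_ne_zero ha0 (pow_ne_zero _ hx0)), if_pos]
    rw [mul_pow, hpow x hx0, mul_one, pow_sub_one_eq_one_iff_pow_eq_self hQ ha0,
      ← iterateFrobenius_def, map_neg, iterateFrobenius_def, ha']
  have hy (y : F) (hy0 : y ≠ 0) : ∑ x : F, Finset.card {z : F | z ^ (2 * n) =
        -(a * x ^ (2 * n) + b * x ^ n * y ^ n + c * y ^ (2 * n))} =
      ∑ s : F, Finset.card {r : F | r ^ (2 * n) = -(a * (s ^ n) ^ 2 + b * s ^ n + c)} := by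
    rw [← Equiv.sum_comp (Equiv.mulRight₀ y hy0)]
    refine Finset.sum_congr rfl fun s _ ↦ ?_
    have h1 : -(a * (s * y) ^ (2 * n) + b * (s * y) ^ n * y ^ n + c * y ^ (2 * n)) =
        -(a * (s ^ n) ^ 2 + b * s ^ n + c) * y ^ (2 * n) := by ring
    rw [Equiv.mulRight₀_apply, h1, card_pow_eq_of_mul_eq hn, card_pow_eq_of_mul_eq hn, mul_pow,
      hpow y hy0, mul_one]
    simp [hy0]
  have hη : Set.ncard {t : F | t ^ p ^ v = t ∧ a * t ^ 2 + b * t + c = 0} =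
      Finset.card {t : F | t ^ p ^ v = t ∧ a * t ^ 2 + b * t + c = 0} := by
    rw [← Set.ncard_coe_finset]
    simp
  have hmain := sum_card_pow_eq_neg_quadratic hn hb hc ha' hb' hc'
  rw [← hη] at hmain
  rw [← Finset.add_sum_erase _ _ (Finset.mem_univ (0 : F)), hyzero,
    Finset.sum_congr rfl fun y hy' ↦ hy y (Finset.ne_of_mem_erase hy'), Finset.sum_const,
    Finset.card_erase_of_mem (Finset.mem_univ _), Finset.card_univ, smul_eq_mul] at hN
  set N := Set.ncard {t : F × F × F | t ≠ (0, 0, 0) ∧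
        a * t.1 ^ (2 * n) + b * t.1 ^ n * t.2.1 ^ n + c * t.2.1 ^ (2 * n)
          + t.2.2 ^ (2 * n) = 0}
  set η := Set.ncard {t : F | t ^ p ^ v = t ∧ a * t ^ 2 + b * t + c = 0}
  generalize (∑ s : F, Finset.card {r : F | r ^ (2 * n) = -(a * (s ^ n) ^ 2 + b * s ^ n + c)}) = S
    at hN hmain
  have hN' : N = (Fintype.card F - 1) * (2 * n + S) := by linarith
  rw [hN']
  congr 1
  obtain ⟨m, hm⟩ : ∃ m, 2 * n = m + 1 := ⟨2 * n - 1, by omega⟩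
  obtain ⟨k, hk⟩ : ∃ k, Fintype.card F = k + 1 := ⟨Fintype.card F - 1, by omega⟩
  rw [hk, Nat.add_sub_cancel] at hn
  rw [hk, hm, Nat.add_sub_cancel]
  have hS : S + n * (m * η) = n * (k + 2) := by
    have h1 : 2 * n * (n * (p ^ v - 1)) = n * k := by rw [← hn]; ring
    rw [h1, hm] at hmain
    linarith
  have hle : m * η ≤ k + 2 :=
    Nat.le_of_mul_le_mul_left (hS ▸ Nat.le_add_left _ _) (Nat.pos_of_ne_zero hn0)
  zify [show m * η ≤ k + 1 + 3 by omega] at hS ⊢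
  linarith
end

section
/- Let K be an algebraically closed field with char K ≠ 2, and let a, b, c, d, e, f ∈ K be not all zero, so that P(x,y,z) := a x²y² + b x²z² + c y²z² + xyz·(dx + ey + fz) is a nonzero homogeneous polynomial of degree 4. Then P is irreducible in K[x,y,z] if and only if abc·Δ ≠ 0, where Δ is the determinant of the 3×3 symmetric matrix [[a, d/2, e/2], [d/2, b, f/2], [e/2, f/2, c]]. -/
open MvPolynomial

/-- A primitive quadratic polynomial over a domain whose discriminant is not a square
is irreducible. -/
theorem Polynomial.irreducible_quadratic_of_not_isSquare_discrim {R : Type*} [CommRing R]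
    [IsDomain R] {A B D : R} (hA : A ≠ 0) (hprim : IsRelPrime A D)
    (hdisc : ¬ IsSquare (discrim A B D)) :
    Irreducible (Polynomial.C A * Polynomial.X ^ 2 + Polynomial.C B * Polynomial.X +
      Polynomial.C D) := by
  have hdeg := Polynomial.natDegree_quadratic (b := B) (c := D) hA
  have isUnit_of_natDegree_eq_zero : ∀ p q : Polynomial R,
      Polynomial.C A * Polynomial.X ^ 2 + Polynomial.C B * Polynomial.X + Polynomial.C D = p * q →
      p.natDegree = 0 → IsUnit p := by
    intro p q hpq hp
    obtain ⟨r, rfl⟩ := Polynomial.natDegree_eq_zero.mp hp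
    refine Polynomial.isUnit_C.mpr (hprim ⟨q.coeff 2, ?_⟩ ⟨q.coeff 0, ?_⟩)
    · simpa [Polynomial.coeff_X, Polynomial.coeff_C] using
        congrArg (fun s => Polynomial.coeff s 2) hpq
    · simpa using congrArg (fun s => Polynomial.coeff s 0) hpq
  refine ⟨fun hu => ?_, fun p q hpq => ?_⟩
  · have := Polynomial.natDegree_eq_zero_of_isUnit hu
    omega
  have hpq0 : p * q ≠ 0 := by
    rintro h
    rw [hpq, h] at hdeg
    simp at hdeg
  have hsum : p.natDegree + q.natDegree = 2 := by
    rw [← Polynomial.natDegree_mul (left_ne_zero_of_mul hpq0) (right_ne_zero_of_mul hpq0), ← hpq,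
      hdeg]
  by_cases hp : p.natDegree = 0
  · exact .inl (isUnit_of_natDegree_eq_zero p q hpq hp)
  by_cases hq : q.natDegree = 0
  · exact .inr (isUnit_of_natDegree_eq_zero q p (hpq.trans (mul_comm p q)) hq)
  obtain ⟨u, v, rfl⟩ := Polynomial.exists_eq_X_add_C_of_natDegree_le_one
    (show p.natDegree ≤ 1 by omega)
  obtain ⟨s, t, rfl⟩ := Polynomial.exists_eq_X_add_C_of_natDegree_le_one
    (show q.natDegree ≤ 1 by omega)
  have hexp : (Polynomial.C u * Polynomial.X + Polynomial.C v) *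
      (Polynomial.C s * Polynomial.X + Polynomial.C t) =
      Polynomial.C (u * s) * Polynomial.X ^ 2 + Polynomial.C (u * t + v * s) * Polynomial.X +
        Polynomial.C (v * t) := by
    simp only [map_mul, map_add]
    ring
  rw [hexp] at hpq
  have h2 : A = u * s := by
    simpa [Polynomial.coeff_X, Polynomial.coeff_C, -map_mul, -map_add] using
      congrArg (fun r => Polynomial.coeff r 2) hpq
  have h1 : B = u * t + v * s := by
    simpa [Polynomial.coeff_X, Polynomial.coeff_C, -map_mul, -map_add] using
      congrArg (fun r => Polynomial.coeff r 1) hpq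
  have h0 : D = v * t := by simpa using congrArg (fun r => Polynomial.coeff r 0) hpq
  refine absurd ⟨u * t - v * s, ?_⟩ hdisc
  rw [discrim, h2, h1, h0]
  ring

/-- A binary quadratic form that is the square of a polynomial has discriminant zero. -/
theorem MvPolynomial.discrim_eq_zero_of_isSquare {K : Type*} [Field K] [IsAlgClosed K]
    (h2 : (2 : K) ≠ 0) {α β γ : K}
    (h : IsSquare (C α * X 0 ^ 2 + C β * (X 0 * X 1) + C γ * X 1 ^ 2 :
      MvPolynomial (Fin 2) K)) :
    discrim α β γ = 0 := by
  obtain ⟨t, ht⟩ := h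
  have hroot : ∀ y : K, α * y ^ 2 + β * y + γ = 0 → 2 * α * y + β = 0 := by
    intro y hy
    have hval := congrArg (eval ![y, 1]) ht
    have hder := congrArg (fun p => eval ![y, 1] (pderiv 0 p)) ht
    simp [pderiv_X] at hval hder
    have ht0 : eval ![y, 1] t = 0 := by
      rw [← mul_self_eq_zero, ← hval, hy]
    rw [ht0] at hder
    linear_combination hder
  by_cases hα : α = 0
  · by_contra hd
    have hβ : β ≠ 0 := by
      rintro rfl
      simp [discrim, hα] at hd
    have := hroot (-γ / β) (by rw [hα]; field_simp; ring)
    simp [hα, hβ] at this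
  · have : NeZero (2 : K) := ⟨h2⟩
    obtain ⟨s, hs⟩ := IsAlgClosed.exists_eq_mul_self (discrim α β γ)
    obtain ⟨y, hy⟩ := exists_quadratic_eq_zero hα ⟨s, hs⟩
    have hy' : α * y ^ 2 + β * y + γ = 0 := by linear_combination hy
    have := hroot y hy'
    rw [discrim]
    linear_combination (2 * α * y + β) * this - 4 * α * hy'

theorem MvPolynomial.not_irreducible_of_eq_mul_of_eval_zero {σ K : Type*} [Field K]
    {p q r : MvPolynomial σ K} (hr : r = p * q) (hp : eval 0 p = 0) (hq : eval 0 q = 0) :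
    ¬ Irreducible r := by
  have not_isUnit : ∀ s : MvPolynomial σ K, eval 0 s = 0 → ¬ IsUnit s := fun s hs hu =>
    (hu.map (eval (0 : σ → K))).ne_zero hs
  exact fun h => (h.isUnit_or_isUnit hr).elim (not_isUnit p hp) (not_isUnit q hq)

theorem discrim_conic {K : Type*} [Field K] (h2 : (2 : K) ≠ 0) (a b c d e f : K) :
    discrim (e ^ 2 - 4 * a * c) (2 * e * f - 4 * c * d) (f ^ 2 - 4 * b * c) =
      -(64 * c *
        Matrix.det !![a, d / 2, e / 2; d / 2, b, f / 2; e / 2, f / 2, c]) := by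
  simp only [discrim, Matrix.det_fin_three, Matrix.of_apply, Matrix.cons_val]
  field_simp
  ring

theorem not_irreducible_quartic_of_discrim_eq_zero {K : Type*} [Field K] [IsAlgClosed K]
    (h2 : (2 : K) ≠ 0) {a b c d e f : K} (hc : c ≠ 0)
    (hdisc : discrim (e ^ 2 - 4 * a * c) (2 * e * f - 4 * c * d) (f ^ 2 - 4 * b * c) = 0) :
    ¬ Irreducible (C a * (X 0 * X 1) ^ 2 + C b * (X 0 * X 2) ^ 2 + C c * (X 1 * X 2) ^ 2
        + X 0 * X 1 * X 2 * (C d * X 0 + C e * X 1 + C f * X 2) :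
        MvPolynomial (Fin 3) K) := by
  obtain ⟨p, q, hp, hq, hpq⟩ : ∃ p q : K, p ^ 2 = e ^ 2 - 4 * a * c ∧
      q ^ 2 = f ^ 2 - 4 * b * c ∧ 2 * p * q = 2 * e * f - 4 * c * d := by
    obtain ⟨p, hp⟩ := IsAlgClosed.exists_pow_nat_eq (e ^ 2 - 4 * a * c) two_pos
    obtain ⟨q, hq⟩ := IsAlgClosed.exists_pow_nat_eq (f ^ 2 - 4 * b * c) two_pos
    have hsq : (2 * e * f - 4 * c * d) ^ 2 = (2 * p * q) ^ 2 := by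
      rw [discrim, ← hp, ← hq] at hdisc
      linear_combination hdisc
    rcases sq_eq_sq_iff_eq_or_eq_neg.mp hsq with h | h
    · exact ⟨p, q, hp, hq, h.symm⟩
    · exact ⟨p, -q, hp, by rw [neg_sq, hq], by rw [h]; ring⟩
  have h4c : 4 * c ≠ 0 := by
    rw [show (4 : K) = 2 * 2 by norm_num]
    exact mul_ne_zero (mul_ne_zero h2 h2) hc
  have hinv : (C (4 * c)⁻¹ * (4 * C c) : MvPolynomial (Fin 3) K) = 1 := by
    rw [show (4 : MvPolynomial (Fin 3) K) = C 4 from (map_ofNat C 4).symm, ← C_mul, ← C_mul,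
      inv_mul_cancel₀ h4c, C_1]
  have hp' := congrArg (C (σ := Fin 3)) hp
  have hq' := congrArg (C (σ := Fin 3)) hq
  have hpq' := congrArg (C (σ := Fin 3)) hpq
  simp only [map_pow, map_sub, map_mul, map_ofNat] at hp' hq' hpq'
  have hfac : (C a * (X 0 * X 1) ^ 2 + C b * (X 0 * X 2) ^ 2 + C c * (X 1 * X 2) ^ 2
        + X 0 * X 1 * X 2 * (C d * X 0 + C e * X 1 + C f * X 2) : MvPolynomial (Fin 3) K) =
      (C (4 * c)⁻¹ * (2 * C c * (X 1 * X 2) + (C e - C p) * (X 0 * X 1) +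
        (C f - C q) * (X 0 * X 2))) *
      (2 * C c * (X 1 * X 2) + (C e + C p) * (X 0 * X 1) + (C f + C q) * (X 0 * X 2)) := by
    linear_combination (-(C a * (X 0 * X 1) ^ 2 + C b * (X 0 * X 2) ^ 2 + C c * (X 1 * X 2) ^ 2
        + X 0 * X 1 * X 2 * (C d * X 0 + C e * X 1 + C f * X 2))) * hinv +
      C (4 * c)⁻¹ * ((X 0 * X 1) ^ 2 * hp' + (X 0 * X 2) ^ 2 * hq' +
        (X 0 * X 1) * (X 0 * X 2) * hpq')
  exact not_irreducible_of_eq_mul_of_eval_zero hfac (by simp) (by simp)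

theorem irreducible_quartic_of_discrim_ne_zero {K : Type*} [Field K] [IsAlgClosed K]
    (h2 : (2 : K) ≠ 0) {a b c d e f : K} (ha : a ≠ 0) (hb : b ≠ 0) (hc : c ≠ 0)
    (hdisc : discrim (e ^ 2 - 4 * a * c) (2 * e * f - 4 * c * d) (f ^ 2 - 4 * b * c) ≠ 0) :
    Irreducible (C a * (X 0 * X 1) ^ 2 + C b * (X 0 * X 2) ^ 2 + C c * (X 1 * X 2) ^ 2
        + X 0 * X 1 * X 2 * (C d * X 0 + C e * X 1 + C f * X 2) :
        MvPolynomial (Fin 3) K) := by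
  set A : MvPolynomial (Fin 2) K := C a * X 0 ^ 2 + C d * (X 0 * X 1) + C b * X 1 ^ 2 with hA
  set B : MvPolynomial (Fin 2) K := X 0 * X 1 * (C e * X 0 + C f * X 1) with hB
  set D : MvPolynomial (Fin 2) K := C c * (X 0 * X 1) ^ 2 with hD
  have hX0 : ¬ (X 0 ∣ A) := by
    rintro ⟨q, hq⟩
    have := congrArg (eval ![0, 1]) hq
    simp [hA, hb] at this
  have hX1 : ¬ (X 1 ∣ A) := by
    rintro ⟨q, hq⟩
    have := congrArg (eval ![1, 0]) hq
    simp [hA, ha] at this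
  have hprim : IsRelPrime A D := by
    have hCc : IsUnit (C c : MvPolynomial (Fin 2) K) := (isUnit_iff_ne_zero.mpr hc).map C
    refine IsRelPrime.mul_right hCc.isRelPrime_right (IsRelPrime.pow_right ?_)
    exact .mul_right ((X_prime.irreducible.isRelPrime_iff_not_dvd.mpr hX0).symm)
      ((X_prime.irreducible.isRelPrime_iff_not_dvd.mpr hX1).symm)
  have hsq : ¬ IsSquare (discrim A B D) := by
    rintro ⟨s, hs⟩
    have hs' : (X 0 * X 1) ^ 2 * (C (e ^ 2 - 4 * a * c) * X 0 ^ 2 +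
        C (2 * e * f - 4 * c * d) * (X 0 * X 1) + C (f ^ 2 - 4 * b * c) * X 1 ^ 2) = s ^ 2 := by
      rw [sq s, ← hs, discrim, hA, hB, hD]
      simp only [map_pow, map_sub, map_mul, map_ofNat]
      ring
    obtain ⟨t, rfl⟩ := (IsIntegrallyClosed.pow_dvd_pow_iff two_ne_zero).mp ⟨_, hs'.symm⟩
    refine hdisc (discrim_eq_zero_of_isSquare h2 ⟨t, ?_⟩)
    rw [mul_pow _ t] at hs'
    rw [← sq t]
    exact mul_left_cancel₀ (pow_ne_zero 2 (mul_ne_zero (X_ne_zero 0) (X_ne_zero 1))) hs'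
  have hA0 : A ≠ 0 := fun h => hX0 (h ▸ dvd_zero _)
  have hirr := Polynomial.irreducible_quadratic_of_not_isSquare_discrim
    hA0 hprim hsq
  rw [← MulEquiv.irreducible_iff (finSuccEquiv K 2)]
  convert hirr using 1
  have hone : finSuccEquiv K 2 (X 1) = Polynomial.C (X 0) := finSuccEquiv_X_succ (j := 0)
  have htwo : finSuccEquiv K 2 (X 2) = Polynomial.C (X 1) := finSuccEquiv_X_succ (j := 1)
  have hC (r : K) : finSuccEquiv K 2 (C r) = Polynomial.C (C r) := by simp [finSuccEquiv_apply]
  simp only [hA, hB, hD, map_add, map_mul, map_pow, hone, htwo, hC, finSuccEquiv_X_zero]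
  ring

/-- Lemma A.1: the quartic `a x²y² + b x²z² + c y²z² + xyz(dx + ey + fz)` is
irreducible iff `abc · Δ ≠ 0`, where `Δ` is the determinant of the associated conic. -/
theorem stmt_9 (K : Type*) [Field K] [IsAlgClosed K] (h2 : (2 : K) ≠ 0)
    (a b c d e f : K)
    (hne : ¬ (a = 0 ∧ b = 0 ∧ c = 0 ∧ d = 0 ∧ e = 0 ∧ f = 0)) :
    Irreducible (C a * (X 0 * X 1) ^ 2 + C b * (X 0 * X 2) ^ 2 + C c * (X 1 * X 2) ^ 2
        + X 0 * X 1 * X 2 * (C d * X 0 + C e * X 1 + C f * X 2) :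
        MvPolynomial (Fin 3) K) ↔
      a * b * c *
        Matrix.det !![a, d / 2, e / 2; d / 2, b, f / 2; e / 2, f / 2, c] ≠ 0 := by
  have hΔ := discrim_conic h2 a b c d e f
  constructor
  · intro h hzero
    have ha : a ≠ 0 := by
      rintro rfl
      refine not_irreducible_of_eq_mul_of_eval_zero (p := X 2) (q := C b * (X 0 ^ 2 * X 2) +
        C c * (X 1 ^ 2 * X 2) + X 0 * X 1 * (C d * X 0 + C e * X 1 + C f * X 2))
        ?_ (by simp) (by simp) h
      rw [C_0]
      ring
    have hb : b ≠ 0 := by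
      rintro rfl
      refine not_irreducible_of_eq_mul_of_eval_zero (p := X 1) (q := C a * (X 0 ^ 2 * X 1) +
        C c * (X 1 * X 2 ^ 2) + X 0 * X 2 * (C d * X 0 + C e * X 1 + C f * X 2))
        ?_ (by simp) (by simp) h
      rw [C_0]
      ring
    have hc : c ≠ 0 := by
      rintro rfl
      refine not_irreducible_of_eq_mul_of_eval_zero (p := X 0) (q := C a * (X 0 * X 1 ^ 2) +
        C b * (X 0 * X 2 ^ 2) + X 1 * X 2 * (C d * X 0 + C e * X 1 + C f * X 2))
        ?_ (by simp) (by simp) h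
      rw [C_0]
      ring
    have hdet := (mul_eq_zero.mp hzero).resolve_left (mul_ne_zero (mul_ne_zero ha hb) hc)
    rw [hdet, mul_zero, neg_zero] at hΔ
    exact not_irreducible_quartic_of_discrim_eq_zero h2 hc hΔ h
  · intro h
    have habc := left_ne_zero_of_mul h
    have hab := left_ne_zero_of_mul habc
    have hc := right_ne_zero_of_mul habc
    refine irreducible_quartic_of_discrim_ne_zero h2 (left_ne_zero_of_mul hab)
      (right_ne_zero_of_mul hab) hc ?_
    have h64 : (64 : K) ≠ 0 := by
      rw [show (64 : K) = 2 ^ 6 by norm_num]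
      exact pow_ne_zero 6 h2
    rw [hΔ]
    exact neg_ne_zero.mpr (mul_ne_zero (mul_ne_zero h64 hc) (right_ne_zero_of_mul h))
end

section
/- Let K be a field with char K ≠ 2, let b, d, e ∈ K, and let F(x,y,z) = ((x+y+z)² − b²xy − d²xz + e²yz)² − 4((bd − e)x − ey − ez)²·yz. Then the three triples P₁ = (e², d², bde − d² − e²), P₂ = (e², bde − b² − e², b²), and P₃ = (bde − d² − b², d², b²) satisfy F(P₁) = F(P₂) = F(P₃) = 0. Moreover, the determinant of the 3×3 matrix whose rows are P₁, P₂, P₃ vanishes if and only if bde·(b² + d² + e² − bde) = 0; that is, P₁, P₂, P₃ are collinear exactly when bde(b²+d²+e²−bde)=0. -/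
/-- Lemma A.2(ii): the three points `P₁, P₂, P₃` lie on the quartic `F = 0`, and they
are collinear exactly when `bde(b² + d² + e² - bde) = 0`. -/
theorem stmt_11 (K : Type*) [Field K] (h2 : (2 : K) ≠ 0) (b d e : K) :
    (((e ^ 2 + d ^ 2 + (b * d * e - d ^ 2 - e ^ 2)) ^ 2
        - b ^ 2 * e ^ 2 * d ^ 2 - d ^ 2 * e ^ 2 * (b * d * e - d ^ 2 - e ^ 2)
        + e ^ 2 * d ^ 2 * (b * d * e - d ^ 2 - e ^ 2)) ^ 2
      - 4 * ((b * d - e) * e ^ 2 - e * d ^ 2 - e * (b * d * e - d ^ 2 - e ^ 2)) ^ 2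
        * d ^ 2 * (b * d * e - d ^ 2 - e ^ 2) = 0) ∧
    (((e ^ 2 + (b * d * e - b ^ 2 - e ^ 2) + b ^ 2) ^ 2
        - b ^ 2 * e ^ 2 * (b * d * e - b ^ 2 - e ^ 2) - d ^ 2 * e ^ 2 * b ^ 2
        + e ^ 2 * (b * d * e - b ^ 2 - e ^ 2) * b ^ 2) ^ 2
      - 4 * ((b * d - e) * e ^ 2 - e * (b * d * e - b ^ 2 - e ^ 2) - e * b ^ 2) ^ 2
        * (b * d * e - b ^ 2 - e ^ 2) * b ^ 2 = 0) ∧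
    ((((b * d * e - d ^ 2 - b ^ 2) + d ^ 2 + b ^ 2) ^ 2
        - b ^ 2 * (b * d * e - d ^ 2 - b ^ 2) * d ^ 2
        - d ^ 2 * (b * d * e - d ^ 2 - b ^ 2) * b ^ 2
        + e ^ 2 * d ^ 2 * b ^ 2) ^ 2
      - 4 * ((b * d - e) * (b * d * e - d ^ 2 - b ^ 2) - e * d ^ 2 - e * b ^ 2) ^ 2
        * d ^ 2 * b ^ 2 = 0) ∧
    (Matrix.det !![e ^ 2, d ^ 2, b * d * e - d ^ 2 - e ^ 2;
                   e ^ 2, b * d * e - b ^ 2 - e ^ 2, b ^ 2;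
                   b * d * e - d ^ 2 - b ^ 2, d ^ 2, b ^ 2] = 0 ↔
      b * d * e * (b ^ 2 + d ^ 2 + e ^ 2 - b * d * e) = 0) := by
  have hdet : Matrix.det !![e ^ 2, d ^ 2, b * d * e - d ^ 2 - e ^ 2;
                   e ^ 2, b * d * e - b ^ 2 - e ^ 2, b ^ 2;
                   b * d * e - d ^ 2 - b ^ 2, d ^ 2, b ^ 2]
      = -(b * d * e * (b ^ 2 + d ^ 2 + e ^ 2 - b * d * e) ^ 2) := by
    rw [Matrix.det_fin_three]
    simp only [Matrix.of_apply, Matrix.cons_val]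
    ring
  refine ⟨by ring, by ring, by ring, ?_⟩
  rw [hdet, neg_eq_zero, mul_eq_zero, mul_eq_zero (a := b * d * e), sq_eq_zero_iff]
end

section
/- Let K be an algebraically closed field with char K ≠ 2, let b, d, e ∈ K be not all zero, and let F(x,y,z) = ((x+y+z)² − b²xy − d²xz + e²yz)² − 4((bd − e)x − ey − ez)²·yz, a nonzero homogeneous quartic in K[x,y,z]. Then F is reducible in K[x,y,z] if and only if at least two of the elements b, d, e are zero, or b² + d² + e² − bde = 4. -/
open MvPolynomial

section TernaryQuadric

variable {K : Type*} [Field K]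

/-- The ternary quadratic form with unit diagonal and off-diagonal coefficients `-b, -d, e`. -/
noncomputable def unitQuadric (b d e : K) : MvPolynomial (Fin 3) K :=
  X 0 ^ 2 + X 1 ^ 2 + X 2 ^ 2 + C e * X 1 * X 2 - C b * X 0 * X 1 - C d * X 0 * X 2

/-- The quartic whose pullback under squaring the variables is a product of four quadrics. -/
noncomputable def normQuartic (b d e : K) : MvPolynomial (Fin 3) K :=
  ((X 0 + X 1 + X 2) ^ 2 - C (b ^ 2) * X 0 * X 1
      - C (d ^ 2) * X 0 * X 2 + C (e ^ 2) * X 1 * X 2) ^ 2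
    - 4 * (C (b * d - e) * X 0 - C e * X 1 - C e * X 2) ^ 2 * X 1 * X 2

/-- The conic whose pullback under squaring the variables is the product of the four lines
`x ± β y ± γ z`. -/
noncomputable def normConic (β γ : K) : MvPolynomial (Fin 3) K :=
  X 0 ^ 2 + C (β ^ 4) * X 1 ^ 2 + C (γ ^ 4) * X 2 ^ 2 - 2 * C (β ^ 2) * X 0 * X 1
    - 2 * C (γ ^ 2) * X 0 * X 2 - 2 * C (β ^ 2 * γ ^ 2) * X 1 * X 2

theorem not_isUnit_normConic (β γ : K) : ¬ IsUnit (normConic β γ) := fun h => by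
  have := h.map (eval (0 : Fin 3 → K))
  simp [normConic] at this

theorem not_irreducible_of_isSquare {R : Type*} [CommMonoid R] {p q : R} (h : p = q ^ 2) :
    ¬ Irreducible p := h ▸ not_irreducible_pow (by norm_num)

theorem normQuartic_eq_mul [Infinite K] {β γ : K} (hβ : β ≠ 0) (hγ : γ ≠ 0) :
    normQuartic (β + β⁻¹) (γ + γ⁻¹) (β * γ⁻¹ + γ * β⁻¹) =
      normConic β γ * normConic β⁻¹ γ⁻¹ := by
  apply MvPolynomial.funext
  intro x
  simp only [normQuartic, normConic, map_sub, map_add, map_mul, map_pow, eval_X, eval_C,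
    map_ofNat]
  field_simp
  ring

theorem exists_add_inv_eq [IsAlgClosed K] (b : K) : ∃ β : K, β ≠ 0 ∧ β + β⁻¹ = b := by
  obtain ⟨β, hβ⟩ := IsAlgClosed.exists_root
    (Polynomial.X ^ 2 + Polynomial.C (-b) * Polynomial.X + Polynomial.C 1 : Polynomial K)
    (by
      have := Polynomial.degree_quadratic (a := (1 : K)) (b := -b) (c := 1) one_ne_zero
      rw [Polynomial.C_1, one_mul] at this
      rw [Polynomial.C_1, this]
      norm_num)
  simp only [Polynomial.IsRoot, Polynomial.eval_add, Polynomial.eval_mul, Polynomial.eval_pow,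
    Polynomial.eval_X, Polynomial.eval_C] at hβ
  have h0 : β ≠ 0 := by
    rintro rfl
    simp at hβ
  refine ⟨β, h0, ?_⟩
  field_simp
  linear_combination hβ

theorem not_irreducible_normQuartic_of_degenerate [IsAlgClosed K] {b d e : K}
    (h : b ^ 2 + d ^ 2 + e ^ 2 - b * d * e = 4) : ¬ Irreducible (normQuartic b d e) := by
  have : Infinite K := IsAlgClosed.instInfinite
  obtain ⟨β, hβ, rfl⟩ := exists_add_inv_eq b
  suffices ∃ γ : K, γ ≠ 0 ∧ γ + γ⁻¹ = d ∧ β * γ⁻¹ + γ * β⁻¹ = e by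
    obtain ⟨γ, hγ, rfl, rfl⟩ := this
    rw [normQuartic_eq_mul hβ hγ]
    intro hi
    exact (hi.isUnit_or_isUnit rfl).elim (not_isUnit_normConic _ _) (not_isUnit_normConic _ _)
  obtain ⟨γ, hγ, rfl⟩ := exists_add_inv_eq d
  have key : (e - (β * γ⁻¹ + γ * β⁻¹)) * (e - (β * γ + γ⁻¹ * β⁻¹)) = 0 := by
    have h' := sub_eq_zero.mpr h
    rw [← h']
    field_simp
    ring
  rcases mul_eq_zero.mp key with h | h
  · exact ⟨γ, hγ, rfl, (sub_eq_zero.mp h).symm⟩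
  · refine ⟨γ⁻¹, inv_ne_zero hγ, by rw [inv_inv, add_comm], ?_⟩
    rw [inv_inv]
    exact (sub_eq_zero.mp h).symm

/-- A linear factor of the quadric forces its discriminant to vanish. -/
theorem degenerate_of_root (h2 : (2 : K) ≠ 0) {b d e : K} {r : MvPolynomial (Fin 2) K}
    (hr : r ^ 2 - (C b * X 0 + C d * X 1) * r + (X 0 ^ 2 + X 1 ^ 2 + C e * X 0 * X 1) = 0) :
    b ^ 2 + d ^ 2 + e ^ 2 - b * d * e = 4 := by
  have h0 : constantCoeff r = 0 := by
    simpa using congrArg constantCoeff hr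
  simp only [sq] at hr
  have second (i j : Fin 2) := congrArg (fun p => constantCoeff (pderiv i (pderiv j p))) hr
  have h00 := second 0 0
  have h01 := second 0 1
  have h11 := second 1 1
  simp only [map_add, map_sub, map_mul, Derivation.leibniz, pderiv_X_self, pderiv_C,
    pderiv_X_of_ne zero_ne_one, pderiv_X_of_ne one_ne_zero, smul_eq_mul, map_zero, map_one,
    Derivation.map_one_eq_zero, constantCoeff_C, constantCoeff_X, h0] at h00 h01 h11
  set α := constantCoeff (pderiv 0 r)
  set γ := constantCoeff (pderiv 1 r)
  have hα : α ^ 2 - b * α + 1 = 0 := by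
    apply mul_left_cancel₀ h2
    linear_combination h00
  have hγ : γ ^ 2 - d * γ + 1 = 0 := by
    apply mul_left_cancel₀ h2
    linear_combination h11
  have he : e = b * γ + d * α - 2 * α * γ := by
    linear_combination h01
  subst he
  linear_combination (d ^ 2 - 4) * hα + (b ^ 2 - 4 + 4 * (α ^ 2 - b * α + 1)) * hγ

theorem irreducible_unitQuadric (h2 : (2 : K) ≠ 0) {b d e : K}
    (h : b ^ 2 + d ^ 2 + e ^ 2 - b * d * e ≠ 4) : Irreducible (unitQuadric b d e) := by
  rw [← MulEquiv.irreducible_iff (finSuccEquiv K 2)]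
  have hq : finSuccEquiv K 2 (unitQuadric b d e) =
      Polynomial.X ^ 2 + Polynomial.C (-(C b * X 0 + C d * X 1)) * Polynomial.X +
        Polynomial.C (X 0 ^ 2 + X 1 ^ 2 + C e * X 0 * X 1) := by
    have h1 : (1 : Fin 3) = Fin.succ 0 := rfl
    have h2 : (2 : Fin 3) = Fin.succ 1 := rfl
    simp only [unitQuadric, map_add, map_sub, map_mul, map_pow, h1, h2,
      finSuccEquiv_apply, eval₂Hom_C, map_neg, eval₂Hom_X', Fin.cases_zero,
      Fin.cases_succ, RingHom.comp_apply]
    ring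
  rw [hq]
  set m : Polynomial (MvPolynomial (Fin 2) K) := _ with hm
  have hdeg : m.natDegree = 2 := by
    have := Polynomial.natDegree_quadratic (R := MvPolynomial (Fin 2) K) (a := 1)
      (b := -(C b * X 0 + C d * X 1)) (c := X 0 ^ 2 + X 1 ^ 2 + C e * X 0 * X 1) one_ne_zero
    rwa [Polynomial.C_1, one_mul] at this
  have hmonic : m.Monic := by
    have := Polynomial.leadingCoeff_quadratic (R := MvPolynomial (Fin 2) K) (a := 1)
      (b := -(C b * X 0 + C d * X 1)) (c := X 0 ^ 2 + X 1 ^ 2 + C e * X 0 * X 1) one_ne_zero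
    rwa [Polynomial.C_1, one_mul] at this
  rw [hmonic.irreducible_iff_roots_eq_zero_of_degree_le_three hdeg.ge (by omega)]
  refine Multiset.eq_zero_of_forall_notMem fun r hr => h ?_
  have hr := (Polynomial.mem_roots'.mp hr).2
  simp only [hm, Polynomial.IsRoot, Polynomial.eval_add, Polynomial.eval_mul, Polynomial.eval_pow,
    Polynomial.eval_X, Polynomial.eval_C] at hr
  exact degenerate_of_root (r := r) h2 (by linear_combination hr)

theorem eq_of_unitQuadric_associated {b d e b' d' e' : K}
    (h : Associated (unitQuadric b d e) (unitQuadric b' d' e')) : b = b' ∧ d = d' ∧ e = e' := by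
  obtain ⟨u, hu⟩ := h
  obtain ⟨c, -, hc⟩ := MvPolynomial.isUnit_iff_eq_C_of_isReduced.mp u.isUnit
  rw [hc] at hu
  have value (v : Fin 3 → K) := congrArg (eval v) hu
  have h0 := value ![1, 0, 0]
  have h01 := value ![1, 1, 0]
  have h02 := value ![1, 0, 1]
  have h12 := value ![0, 1, 1]
  simp [unitQuadric] at h0 h01 h02 h12
  subst h0
  refine ⟨?_, ?_, ?_⟩
  · linear_combination -h01
  · linear_combination -h02
  · linear_combination h12

theorem isRelPrime_unitQuadric (h2 : (2 : K) ≠ 0) {b d e b' d' e' : K}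
    (h : b ^ 2 + d ^ 2 + e ^ 2 - b * d * e ≠ 4) (h' : b' ^ 2 + d' ^ 2 + e' ^ 2 - b' * d' * e' ≠ 4)
    (hne : ¬ (b = b' ∧ d = d' ∧ e = e')) :
    IsRelPrime (unitQuadric b d e) (unitQuadric b' d' e') := by
  have hi := irreducible_unitQuadric h2 h
  rw [hi.isRelPrime_iff_not_dvd]
  exact fun hd => hne (eq_of_unitQuadric_associated
    (hi.associated_of_dvd (irreducible_unitQuadric h2 h') hd))

theorem expand_normQuartic (b d e : K) : expand 2 (normQuartic b d e) =
    unitQuadric b d e * unitQuadric (-b) (-d) e * unitQuadric (-b) d (-e) *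
      unitQuadric b (-d) (-e) := by
  simp only [normQuartic, unitQuadric, map_sub, map_add, map_mul, map_pow, map_neg, expand_X,
    expand_C, map_ofNat]
  ring

/-- Rescaling the variables by signs fixes polynomials in the squares of the variables. -/
theorem aeval_sign_expand {ε : Fin 3 → K} (hε : ∀ i, ε i ^ 2 = 1) (p : MvPolynomial (Fin 3) K) :
    aeval (fun i => C (ε i) * X i) (expand 2 p) = expand 2 p := by
  rw [← AlgHom.comp_apply]
  congr 1
  refine MvPolynomial.algHom_ext fun i => ?_
  rw [AlgHom.comp_apply, expand_X, map_pow, aeval_X, mul_pow, ← map_pow, hε, map_one, one_mul]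

theorem aeval_sign_unitQuadric {ε : Fin 3 → K} (hε : ∀ i, ε i ^ 2 = 1) (b d e : K) :
    aeval (fun i => C (ε i) * X i) (unitQuadric b d e) =
      unitQuadric (ε 0 * ε 1 * b) (ε 0 * ε 2 * d) (ε 1 * ε 2 * e) := by
  have hC (i) : (C (ε i) : MvPolynomial (Fin 3) K) ^ 2 = 1 := by
    rw [← map_pow, hε, map_one]
  simp only [unitQuadric, map_sub, map_add, map_mul, map_pow, aeval_X, algHom_C,
    algebraMap_eq, mul_pow, hC]
  ring

theorem isUnit_of_unitQuadric_dvd (h2 : (2 : K) ≠ 0) {b d e : K}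
    (h : b ^ 2 + d ^ 2 + e ^ 2 - b * d * e ≠ 4)
    (hbd : ¬ (b = 0 ∧ d = 0)) (hbe : ¬ (b = 0 ∧ e = 0)) (hde : ¬ (d = 0 ∧ e = 0))
    {p r : MvPolynomial (Fin 3) K} (hF : normQuartic b d e = p * r)
    (hp : unitQuadric b d e ∣ expand 2 p) : IsUnit r := by
  have neg_eq (a : K) : -a = a ↔ a = 0 := by
    rw [neg_eq_iff_add_eq_zero, ← two_mul, mul_eq_zero, or_iff_right h2]
  have eq_neg (a : K) : a = -a ↔ a = 0 := by rw [eq_comm, neg_eq]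
  have conj {ε : Fin 3 → K} (hε : ∀ i, ε i ^ 2 = 1) :
      unitQuadric (ε 0 * ε 1 * b) (ε 0 * ε 2 * d) (ε 1 * ε 2 * e) ∣ expand 2 p := by
    rw [← aeval_sign_unitQuadric hε, ← aeval_sign_expand hε p]
    exact map_dvd _ hp
  have hp0 : unitQuadric (-b) (-d) e ∣ expand 2 p := by
    simpa using conj (ε := ![-1, 1, 1]) (by intro i; fin_cases i <;> simp)
  have hp1 : unitQuadric (-b) d (-e) ∣ expand 2 p := by
    simpa using conj (ε := ![1, -1, 1]) (by intro i; fin_cases i <;> simp)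
  have hp2 : unitQuadric b (-d) (-e) ∣ expand 2 p := by
    simpa using conj (ε := ![1, 1, -1]) (by intro i; fin_cases i <;> simp)
  have h0 : (-b) ^ 2 + (-d) ^ 2 + e ^ 2 - (-b) * (-d) * e ≠ 4 := by convert h using 1; ring
  have h1 : (-b) ^ 2 + d ^ 2 + (-e) ^ 2 - (-b) * d * (-e) ≠ 4 := by convert h using 1; ring
  have h3 : b ^ 2 + (-d) ^ 2 + (-e) ^ 2 - b * (-d) * (-e) ≠ 4 := by convert h using 1; ring
  have hdvd : expand 2 (normQuartic b d e) ∣ expand 2 p := by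
    rw [expand_normQuartic]
    refine IsRelPrime.mul_dvd (.mul_left (.mul_left ?_ ?_) ?_)
      (IsRelPrime.mul_dvd (.mul_left ?_ ?_) (IsRelPrime.mul_dvd ?_ hp hp0) hp1) hp2 <;>
    · apply isRelPrime_unitQuadric h2 <;> first | assumption | (simp only [neg_eq, eq_neg]; tauto)
  rw [hF, map_mul] at hdvd
  have hne : expand 2 p ≠ 0 := by
    intro hz
    have hF0 : expand 2 (normQuartic b d e) = 0 := by rw [hF, map_mul, hz, zero_mul]
    rw [expand_normQuartic] at hF0
    simp [(irreducible_unitQuadric h2 h).ne_zero, (irreducible_unitQuadric h2 h0).ne_zero,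
      (irreducible_unitQuadric h2 h1).ne_zero, (irreducible_unitQuadric h2 h3).ne_zero] at hF0
  have hu : IsUnit (expand 2 r) := by
    refine isUnit_of_dvd_one ((mul_dvd_mul_iff_left hne).mp ?_)
    rwa [mul_one]
  obtain ⟨c, hc, hrc⟩ := MvPolynomial.isUnit_iff_eq_C_of_isReduced.mp hu
  rw [← expand_C 2 c] at hrc
  rw [expand_injective two_pos hrc]
  exact hc.map C

theorem irreducible_normQuartic (h2 : (2 : K) ≠ 0) {b d e : K}
    (h : b ^ 2 + d ^ 2 + e ^ 2 - b * d * e ≠ 4)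
    (hbd : ¬ (b = 0 ∧ d = 0)) (hbe : ¬ (b = 0 ∧ e = 0)) (hde : ¬ (d = 0 ∧ e = 0)) :
    Irreducible (normQuartic b d e) := by
  constructor
  · intro hu
    have := hu.map (eval (0 : Fin 3 → K))
    simp [normQuartic] at this
  · intro p r hF
    have hq : unitQuadric b d e ∣ expand 2 p * expand 2 r := by
      rw [← map_mul, ← hF, expand_normQuartic, mul_assoc, mul_assoc]
      exact dvd_mul_right _ _
    rcases (irreducible_unitQuadric h2 h).prime.dvd_or_dvd hq with hp | hr
    · exact .inr (isUnit_of_unitQuadric_dvd h2 h hbd hbe hde hF hp)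
    · exact .inl (isUnit_of_unitQuadric_dvd h2 h hbd hbe hde (hF.trans (mul_comm p r)) hr)

theorem not_irreducible_normQuartic_of_two_zero {b d e : K}
    (h : (b = 0 ∧ d = 0) ∨ (b = 0 ∧ e = 0) ∨ (d = 0 ∧ e = 0)) :
    ¬ Irreducible (normQuartic b d e) := by
  rcases h with ⟨rfl, rfl⟩ | ⟨rfl, rfl⟩ | ⟨rfl, rfl⟩
  · apply not_irreducible_of_isSquare (q := (X 0 + X 1 + X 2) ^ 2 - C (e ^ 2) * X 1 * X 2)
    simp [normQuartic]
    ring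
  · apply not_irreducible_of_isSquare (q := (X 0 + X 1 + X 2) ^ 2 - C (d ^ 2) * X 0 * X 2)
    simp [normQuartic]
  · apply not_irreducible_of_isSquare (q := (X 0 + X 1 + X 2) ^ 2 - C (b ^ 2) * X 0 * X 1)
    simp [normQuartic]

end TernaryQuadric

/-- Theorem A.3: the quartic `F` is reducible iff at least two of `b, d, e` are zero
or `b² + d² + e² - bde = 4`. -/
theorem stmt_12 (K : Type*) [Field K] [IsAlgClosed K] (h2 : (2 : K) ≠ 0)
    (b d e : K) (hne : ¬ (b = 0 ∧ d = 0 ∧ e = 0)) :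
    ¬ Irreducible (((X 0 + X 1 + X 2) ^ 2 - C (b ^ 2) * X 0 * X 1
          - C (d ^ 2) * X 0 * X 2 + C (e ^ 2) * X 1 * X 2) ^ 2
        - 4 * (C (b * d - e) * X 0 - C e * X 1 - C e * X 2) ^ 2 * X 1 * X 2 :
          MvPolynomial (Fin 3) K) ↔
      ((b = 0 ∧ d = 0) ∨ (b = 0 ∧ e = 0) ∨ (d = 0 ∧ e = 0)) ∨
        b ^ 2 + d ^ 2 + e ^ 2 - b * d * e = 4 := by
  change ¬ Irreducible (normQuartic b d e) ↔ _
  constructor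
  · contrapose!
    rintro ⟨⟨hbd, hbe, hde⟩, h⟩
    exact irreducible_normQuartic h2 h (by tauto) (by tauto) (by tauto)
  · rintro (h | h)
    · exact not_irreducible_normQuartic_of_two_zero h
    · exact not_irreducible_normQuartic_of_degenerate h
end

section
/- Let K be an algebraically closed field of characteristic p ≥ 0, let H ∈ K[x,y,z] be homogeneous of positive degree, and let n ≥ 2 and m ≥ 1 be integers with p ∤ m (no condition if p = 0). If the polynomial H(x^n, y^n, z^n) and its three partial derivatives have no common zero in K³ other than (0,0,0), then the polynomial H(x^m, y^m, z^m) and its three partial derivatives also have no common zero in K³ other than (0,0,0). (This smoothness transfer is used in the proofs of Lemma 4.4 and Theorem 3.3: nonsingularity of the curve G(x^n,y^n,z^n) = 0 forces nonsingularity of the curves G(x^m,y^m,z^m) = 0.) -/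
open MvPolynomial

/-- Chain rule for the substitution of `n`-th powers of the variables. -/
theorem pderiv_bind₁_X_pow {R σ : Type*} [CommRing R] (n : ℕ) (j : σ) (F : MvPolynomial σ R) :
    pderiv j (bind₁ (fun i => (X i : MvPolynomial σ R) ^ n) F) =
      bind₁ (fun i => (X i : MvPolynomial σ R) ^ n) (pderiv j F) *
        ((n : MvPolynomial σ R) * X j ^ (n - 1)) := by
  classical
  induction F using MvPolynomial.induction_on with
  | C a => simp
  | add f g hf hg => simp only [map_add, hf, hg, add_mul]
  | mul_X f i hf =>
    simp only [map_mul, Derivation.leibniz, smul_eq_mul, hf, bind₁_X_right, map_add, pderiv_X,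
      Derivation.leibniz_pow, nsmul_eq_mul]
    rcases eq_or_ne i j with rfl | h
    · simp
      ring
    · rw [Pi.single_eq_of_ne h]
      simp only [mul_zero, map_zero, zero_add]
      ring

theorem eval_bind₁_X_pow {R σ : Type*} [CommRing R] (n : ℕ) (P : σ → R) (F : MvPolynomial σ R) :
    eval P (bind₁ (fun i => (X i : MvPolynomial σ R) ^ n) F) = eval (fun i => P i ^ n) F := by
  simp only [eval, eval₂Hom_bind₁]
  simp

/-- Smoothness transfer: if `H(x^n, y^n, z^n)` and its partial derivatives have no
common zero other than the origin, the same holds for `H(x^m, y^m, z^m)` with `p ∤ m`. -/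
theorem stmt_14 (K : Type*) [Field K] [IsAlgClosed K] (p : ℕ) [CharP K p]
    (H : MvPolynomial (Fin 3) K) (k : ℕ) (hk : 0 < k) (hhom : H.IsHomogeneous k)
    (n m : ℕ) (hn : 2 ≤ n) (hm : 1 ≤ m) (hpm : ¬ p ∣ m)
    (hsmooth : ∀ P : Fin 3 → K,
        eval P (bind₁ (fun i => (X i : MvPolynomial (Fin 3) K) ^ n) H) = 0 →
        (∀ j : Fin 3,
          eval P (pderiv j (bind₁ (fun i => (X i : MvPolynomial (Fin 3) K) ^ n) H)) = 0) →
        P = 0) :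
    ∀ P : Fin 3 → K,
      eval P (bind₁ (fun i => (X i : MvPolynomial (Fin 3) K) ^ m) H) = 0 →
      (∀ j : Fin 3,
        eval P (pderiv j (bind₁ (fun i => (X i : MvPolynomial (Fin 3) K) ^ m) H)) = 0) →
      P = 0 := by
  intro P h0 hd
  have hm_ne : (m : K) ≠ 0 := fun h => hpm ((CharP.cast_eq_zero_iff K p m).mp h)
  have hn_pos : 0 < n := by omega
  choose Q hQ using fun i => IsAlgClosed.exists_pow_nat_eq (P i ^ m) hn_pos
  have hQ_zero : Q = 0 := by
    simp only [pderiv_bind₁_X_pow, eval_bind₁_X_pow, map_mul, map_pow, eval_X, map_natCast]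
      at h0 hd hsmooth
    refine hsmooth Q (by simpa only [hQ] using h0) fun j => ?_
    simp only [hQ]
    rcases eq_or_ne (P j) 0 with hP | hP
    · have hQj : Q j = 0 := by
        have h := hQ j
        rw [hP, zero_pow (by omega)] at h
        exact eq_zero_of_pow_eq_zero h
      rw [hQj, zero_pow (by omega), mul_zero, mul_zero]
    · rw [(mul_eq_zero.mp (hd j)).resolve_right (mul_ne_zero hm_ne (pow_ne_zero _ hP)), zero_mul]
  funext i
  have h := hQ i
  rw [hQ_zero, Pi.zero_apply, zero_pow hn_pos.ne'] at h
  exact eq_zero_of_pow_eq_zero h.symm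
end
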